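/- arXiv:2109.06588 — 2 statements merged into one kernel-verified Lean document; each statement's English description precedes it below -/
import Mathlib

section
/- Let m ≤ n and let A, B be nonzero real m×n matrices. Let p, q ∈ (1,∞) satisfy 1/p + 1/q = 1. Then equality tr(A^* B) = (tr(|A|^p))^{1/p} · (tr(|B|^q))^{1/q} holds if and only if B^* A is symmetric and positive semidefinite and there exists a constant c > 0 such that A^* B = B^* A = c^p (A^* A)^{p/2} = c^{-q} (B^* B)^{q/2}. Equivalently, equality holds if and only if A^* B / (‖A‖_p ‖B‖_q) = B^* A / (‖A‖_p ‖B‖_q) = (A^* A)^{p/2} / tr(|A|^p) = (B^* B)^{q/2} / tr(|B|^q). -/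
open Matrix

noncomputable section

/-- Real power of a square real matrix via spectral decomposition (defined for
Hermitian/symmetric matrices; junk value `0` otherwise).  For a positive
semidefinite `A` this is the usual power defined by functional calculus. -/
def matPow {n : ℕ} (A : Matrix (Fin n) (Fin n) ℝ) (r : ℝ) : Matrix (Fin n) (Fin n) ℝ :=
  if hA : A.IsHermitian then
    (hA.eigenvectorUnitary : Matrix (Fin n) (Fin n) ℝ) *
      Matrix.diagonal (fun i => (hA.eigenvalues i) ^ r) *
      (star hA.eigenvectorUnitary : Matrix.unitaryGroup (Fin n) ℝ)
  else 0

/-- Absolute value `|A| = (A^* A)^{1/2}` of a real rectangular matrix. -/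
def matAbs {m n : ℕ} (A : Matrix (Fin m) (Fin n) ℝ) : Matrix (Fin n) (Fin n) ℝ :=
  matPow (Aᴴ * A) (1/2)

/-- Operator (spectral) norm of a matrix acting between Euclidean spaces. -/
def matOpNorm {m n : ℕ} (A : Matrix (Fin m) (Fin n) ℝ) : ℝ :=
  ‖LinearMap.toContinuousLinearMap (Matrix.toEuclideanLin A)‖


lemma matPow_eq_cfc {n : ℕ} {A : Matrix (Fin n) (Fin n) ℝ} (hA : A.IsHermitian) (r : ℝ) :
    matPow A r = cfc (fun x : ℝ => x ^ r) A := by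
  rw [hA.cfc_eq, Matrix.IsHermitian.cfc, Unitary.conjStarAlgAut_apply, matPow, dif_pos hA]
  rfl

lemma gram_psd {m n : ℕ} (A : Matrix (Fin m) (Fin n) ℝ) : (Aᴴ * A).PosSemidef :=
  Matrix.posSemidef_conjTranspose_mul_self A

lemma matPow_matAbs {m n : ℕ} (A : Matrix (Fin m) (Fin n) ℝ) (p : ℝ) :
    matPow (matAbs A) p = matPow (Aᴴ * A) (p/2) := by
  have hH := (gram_psd A).isHermitian
  have h1 : matAbs A = cfc (fun x : ℝ => x ^ (1/2 : ℝ)) (Aᴴ * A) := matPow_eq_cfc hH _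
  have h2 : (matAbs A).IsHermitian := by
    rw [h1]; exact (cfc_predicate (R := ℝ) (p := IsSelfAdjoint) _ _)
  have hfin : (spectrum ℝ (Aᴴ * A)).Finite := Matrix.finite_real_spectrum
  rw [matPow_eq_cfc h2, matPow_eq_cfc hH, h1, ← cfc_comp' (hg := ?_) (hf := ?_)]
  · apply cfc_congr
    intro x hx
    rw [hH.spectrum_real_eq_range_eigenvalues] at hx
    obtain ⟨i, rfl⟩ := hx
    have := (gram_psd A).eigenvalues_nonneg i
    simp only
    rw [← Real.rpow_mul this]
    congr 1; ring
  · exact (hfin.image _).continuousOn _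
  · exact hfin.continuousOn _

lemma svd_exists {m n : ℕ} (A : Matrix (Fin m) (Fin n) ℝ) :
    ∃ (V : Matrix (Fin n) (Fin n) ℝ) (α : Fin n → ℝ) (U : Matrix (Fin m) (Fin n) ℝ)
      (e : Fin n → ℝ), Vᵀ * V = 1 ∧ V * Vᵀ = 1 ∧ (∀ i, 0 ≤ α i) ∧
      A = U * diagonal α * Vᵀ ∧ (∀ i, e i ≤ 1) ∧ Uᵀ * U = diagonal e ∧ U * (Uᵀ * U) = U ∧
      ∀ r, matPow (Aᴴ * A) (r/2) = V * diagonal (fun i => α i ^ r) * Vᵀ := by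
  have hP := gram_psd A
  have hH := hP.isHermitian
  set V : Matrix (Fin n) (Fin n) ℝ := (hH.eigenvectorUnitary : Matrix (Fin n) (Fin n) ℝ) with hV
  have hs : star V = Vᵀ := by
    rw [Matrix.star_eq_conjTranspose, Matrix.conjTranspose_eq_transpose_of_trivial]
  have h1 : Vᵀ * V = 1 := by
    rw [← hs]; exact Unitary.star_mul_self_of_mem hH.eigenvectorUnitary.2
  have h2 : V * Vᵀ = 1 := by
    rw [← hs]; exact Unitary.mul_star_self_of_mem hH.eigenvectorUnitary.2
  set α : Fin n → ℝ := fun i => Real.sqrt (hH.eigenvalues i) with hα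
  have hα0 : ∀ i, 0 ≤ α i := fun i => Real.sqrt_nonneg _
  have hα2 : ∀ i, α i * α i = hH.eigenvalues i := fun i => Real.mul_self_sqrt (hP.eigenvalues_nonneg i)
  have hsp : Aᵀ * A = V * diagonal (fun i => α i * α i) * Vᵀ := by
    have := hH.spectral_theorem
    rw [Unitary.conjStarAlgAut_apply] at this
    rw [← hs, ← Matrix.conjTranspose_eq_transpose_of_trivial A]
    simp only [hα2]
    exact this
  have hG : (A * V)ᵀ * (A * V) = diagonal (fun i => α i * α i) := by
    calc (A * V)ᵀ * (A * V) = Vᵀ * (Aᵀ * A) * V := by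
          rw [Matrix.transpose_mul]; simp only [Matrix.mul_assoc]
      _ = (Vᵀ * V) * diagonal (fun i => α i * α i) * (Vᵀ * V) := by
          rw [hsp]; simp only [Matrix.mul_assoc]
      _ = _ := by rw [h1, Matrix.one_mul, Matrix.mul_one]
  set U := A * V * diagonal (fun i => (α i)⁻¹) with hU
  set e : Fin n → ℝ := fun i => (α i)⁻¹ * (α i * α i) * (α i)⁻¹ with he
  have hUU : Uᵀ * U = diagonal e := by
    calc Uᵀ * U = diagonal (fun i => (α i)⁻¹) * ((A * V)ᵀ * (A * V)) * diagonal (fun i => (α i)⁻¹) := by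
          rw [hU, Matrix.transpose_mul, Matrix.diagonal_transpose]; simp only [Matrix.mul_assoc]
      _ = _ := by rw [hG, Matrix.diagonal_mul_diagonal, Matrix.diagonal_mul_diagonal]
  have hUD : U * diagonal α = A * V := by
    rw [hU, Matrix.mul_assoc, Matrix.diagonal_mul_diagonal]
    ext k i
    rw [Matrix.mul_diagonal]
    by_cases h : α i = 0
    · have h3 := congrFun (congrFun hG i) i
      rw [Matrix.mul_apply, Matrix.diagonal_apply_eq, h, mul_zero] at h3
      simp only [Matrix.transpose_apply] at h3
      rw [Finset.sum_eq_zero_iff_of_nonneg (fun _ _ => mul_self_nonneg _)] at h3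
      have := mul_self_eq_zero.1 (h3 k (Finset.mem_univ _))
      rw [this, zero_mul]
    · rw [inv_mul_cancel₀ h, mul_one]
  refine ⟨V, α, U, e, h1, h2, hα0, ?_, ?_, hUU, ?_, ?_⟩
  · rw [hUD, Matrix.mul_assoc, h2, Matrix.mul_one]
  · intro i
    by_cases h : α i = 0
    · simp [he, h]
    · apply le_of_eq; simp only [he]; field_simp
  · rw [hUU, hU, Matrix.mul_assoc, Matrix.diagonal_mul_diagonal]
    congr 2
    ext i
    by_cases h : α i = 0
    · simp [h]
    · simp only [he]; field_simp
  · intro r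
    rw [matPow, dif_pos hH, ← hs]
    have : (fun i => hH.eigenvalues i ^ (r/2)) = fun i => α i ^ r := by
      ext i
      rw [hα]; simp only
      rw [Real.sqrt_eq_rpow, ← Real.rpow_mul (hP.eigenvalues_nonneg i)]
      congr 1; ring
    rw [this]
    rfl

lemma bessel_row {m n : ℕ} (U Z : Matrix (Fin m) (Fin n) ℝ) (e : Fin n → ℝ)
    (he : ∀ i, e i ≤ 1) (hU : Uᵀ * U = diagonal e) (hZ : Z * (Zᵀ * Z) = Z) (i : Fin n) :
    ∑ j, (Uᵀ * Z) i j ^ 2 ≤ 1 := by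
  have hQ : (U - Z * (Zᵀ * U))ᵀ * (U - Z * (Zᵀ * U)) = Uᵀ * U - (Uᵀ * Z) * (Uᵀ * Z)ᵀ := by
    have h1 : (U - Z * (Zᵀ * U))ᵀ = Uᵀ - (Uᵀ * Z) * Zᵀ := by
      simp [Matrix.transpose_sub, Matrix.transpose_mul, Matrix.mul_assoc]
    have h2 : Z * Zᵀ * (Z * (Zᵀ * U)) = Z * (Zᵀ * U) := by
      calc _ = (Z * (Zᵀ * Z)) * (Zᵀ * U) := by simp only [Matrix.mul_assoc]
        _ = _ := by rw [hZ]
    rw [h1, Matrix.sub_mul, Matrix.mul_sub, Matrix.mul_sub, Matrix.mul_assoc Uᵀ Z Zᵀ,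
      Matrix.mul_assoc Uᵀ (Z * Zᵀ) (Z * (Zᵀ * U)), h2]
    simp [Matrix.transpose_mul, Matrix.mul_assoc]
  have h := congrFun (congrFun hQ i) i
  rw [Matrix.sub_apply, hU, Matrix.diagonal_apply_eq, Matrix.mul_apply, Matrix.mul_apply] at h
  simp only [Matrix.transpose_apply] at h
  have h0 : 0 ≤ ∑ x, (U - Z * (Zᵀ * U)) x i * (U - Z * (Zᵀ * U)) x i :=
    Finset.sum_nonneg fun _ _ => mul_self_nonneg _
  simp only [sq]
  linarith [he i]

lemma young_le {p q a b x y : ℝ} (hp : 1 < p) (hq : 1 < q) (hpq : 1/p + 1/q = 1)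
    (ha : 0 < a) (hb : 0 < b) (hx : 0 ≤ x) (hy : 0 ≤ y) :
    x * y * (a ^ (1/p) * b ^ (1/q))⁻¹ = (x ^ p / a) ^ (1/p) * (y ^ q / b) ^ (1/q) := by
  rw [Real.div_rpow (by positivity) ha.le, Real.div_rpow (by positivity) hb.le,
    ← Real.rpow_mul hx, ← Real.rpow_mul hy, mul_one_div_cancel (by positivity),
    mul_one_div_cancel (by positivity), Real.rpow_one, Real.rpow_one]
  field_simp

lemma amgm_eq {p q X Y : ℝ} (hp : 1 < p) (hq : 1 < q) (hpq : 1/p + 1/q = 1)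
    (hX : 0 ≤ X) (hY : 0 ≤ Y) (h : X ^ (1/p) * Y ^ (1/q) = 1/p * X + 1/q * Y) : X = Y := by
  have hp' : 0 < 1/p := by positivity
  have hq' : 0 < 1/q := by positivity
  have := (Real.geom_mean_eq_arith_mean_weighted_iff_of_pos (Finset.univ : Finset (Fin 2))
    ![1/p, 1/q] ![X, Y] (by intro i _; fin_cases i <;> simpa using by positivity)
    (by simpa using hpq)
    (by intro i _; fin_cases i <;> simpa)).1
    (by simpa using h)
  simpa using this 0 (by simp) 1 (by simp)

lemma trace_conj {n : ℕ} (V : Matrix (Fin n) (Fin n) ℝ) (hV : Vᵀ * V = 1) (d : Fin n → ℝ) :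
    trace (V * diagonal d * Vᵀ) = ∑ i, d i := by
  rw [Matrix.trace_mul_comm, ← Matrix.mul_assoc, hV, Matrix.one_mul, Matrix.trace_diagonal]

lemma trace_pos {m n : ℕ} (A : Matrix (Fin m) (Fin n) ℝ) (hA : A ≠ 0) (r : ℝ) (hr : 0 < r) :
    0 < trace (matPow (Aᴴ * A) (r/2)) := by
  obtain ⟨V, α, U, e, h1, h2, h3, h4, h5, h6, h7, h8⟩ := svd_exists A
  rw [h8, trace_conj V h1]
  have : ∃ i, α i ≠ 0 := by
    by_contra! h
    apply hA
    rw [h4, show α = 0 from funext h]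
    simp
  obtain ⟨i, hi⟩ := this
  exact Finset.sum_pos' (fun j _ => Real.rpow_nonneg (h3 j) _)
    ⟨i, Finset.mem_univ _, Real.rpow_pos_of_pos (lt_of_le_of_ne (h3 i) hi.symm) _⟩

lemma matPow_psd {m n : ℕ} (A : Matrix (Fin m) (Fin n) ℝ) (r : ℝ) :
    (matPow (Aᴴ * A) (r/2)).PosSemidef := by
  obtain ⟨V, α, U, e, h1, h2, h3, h4, h5, h6, h7, h8⟩ := svd_exists A
  rw [h8, ← Matrix.conjTranspose_eq_transpose_of_trivial V]
  exact (Matrix.PosSemidef.diagonal (fun i => Real.rpow_nonneg (h3 i) _)).mul_mul_conjTranspose_same V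

/-- The scalar heart: termwise equality. -/
lemma termwise {n : ℕ} (α β : Fin n → ℝ) (S T : Matrix (Fin n) (Fin n) ℝ) (p q a b : ℝ)
    (hp : 1 < p) (hq : 1 < q) (hpq : 1/p + 1/q = 1) (ha : 0 < a) (hb : 0 < b)
    (hα : ∀ i, 0 ≤ α i) (hβ : ∀ i, 0 ≤ β i)
    (hSr : ∀ i, ∑ j, S i j ^ 2 ≤ 1) (hSc : ∀ j, ∑ i, S i j ^ 2 ≤ 1)
    (hTr : ∀ i, ∑ j, T i j ^ 2 ≤ 1) (hTc : ∀ j, ∑ i, T i j ^ 2 ≤ 1)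
    (hsa : ∑ i, α i ^ p = a) (hsb : ∑ i, β i ^ q = b)
    (heq : ∑ i, ∑ j, α i * β j * S i j * T i j = a ^ (1/p) * b ^ (1/q)) (i j : Fin n) :
    (a ^ (1/p) * b ^ (1/q))⁻¹ * (α i * β j * T i j) = a⁻¹ * (α i ^ p * S i j) ∧
    (a ^ (1/p) * b ^ (1/q))⁻¹ * (α i * β j * T i j) = b⁻¹ * (β j ^ q * S i j) := by
  set N := a ^ (1/p) * b ^ (1/q) with hN
  have hN0 : 0 < N := by positivity
  have hp0 : 0 < 1/p := by positivity
  have hq0 : 0 < 1/q := by positivity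
  set x : Fin n → ℝ := fun i => α i ^ p / a with hx
  set y : Fin n → ℝ := fun j => β j ^ q / b with hy
  have hx0 : ∀ i, 0 ≤ x i := fun i => div_nonneg (Real.rpow_nonneg (hα i) _) ha.le
  have hy0 : ∀ i, 0 ≤ y i := fun i => div_nonneg (Real.rpow_nonneg (hβ i) _) hb.le
  have hxs : ∑ i, x i = 1 := by rw [hx, ← Finset.sum_div, hsa, div_self ha.ne']
  have hys : ∑ i, y i = 1 := by rw [hy, ← Finset.sum_div, hsb, div_self hb.ne']
  set g : Fin n → Fin n → ℝ := fun i j => α i * β j * N⁻¹ with hg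
  have hg0 : ∀ i j, 0 ≤ g i j := fun i j =>
    mul_nonneg (mul_nonneg (hα i) (hβ j)) (inv_nonneg.2 hN0.le)
  have hgx : ∀ i j, g i j = x i ^ (1/p) * y j ^ (1/q) := fun i j =>
    young_le hp hq hpq ha hb (hα i) (hβ j)
  have hgle : ∀ i j, g i j ≤ 1/p * x i + 1/q * y j := fun i j => by
    rw [hgx]
    exact Real.geom_mean_le_arith_mean2_weighted hp0.le hq0.le (hx0 i) (hy0 j) hpq
  set F : Fin n → Fin n → ℝ := fun i j =>
    (1/p * x i + 1/q * y j) * ((S i j ^ 2 + T i j ^ 2) / 2) - g i j * (S i j * T i j) with hF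
  have hsplit : ∀ i j, F i j = (1/p * x i + 1/q * y j - g i j) * ((S i j ^ 2 + T i j ^ 2) / 2)
      + g i j * ((S i j - T i j) ^ 2 / 2) := fun i j => by simp only [hF]; ring
  have hn1 : ∀ i j, 0 ≤ (1/p * x i + 1/q * y j - g i j) * ((S i j ^ 2 + T i j ^ 2) / 2) :=
    fun i j => mul_nonneg (sub_nonneg.2 (hgle i j)) (by positivity)
  have hn2 : ∀ i j, 0 ≤ g i j * ((S i j - T i j) ^ 2 / 2) :=
    fun i j => mul_nonneg (hg0 i j) (by positivity)
  have hF0 : ∀ i j, 0 ≤ F i j := fun i j => by rw [hsplit]; exact add_nonneg (hn1 i j) (hn2 i j)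
  have hsum : ∑ i, ∑ j, F i j ≤ 0 := by
    have e1 : ∑ i, ∑ j, g i j * (S i j * T i j) = 1 := by
      have : ∀ i j, g i j * (S i j * T i j) = N⁻¹ * (α i * β j * S i j * T i j) :=
        fun i j => by simp only [hg]; ring
      simp only [this, ← Finset.mul_sum, heq]
      exact inv_mul_cancel₀ hN0.ne'
    have e2 : ∑ i, ∑ j, x i * ((S i j ^ 2 + T i j ^ 2) / 2) ≤ 1 := by
      rw [← hxs]
      refine Finset.sum_le_sum fun i _ => ?_
      rw [← Finset.mul_sum, ← Finset.sum_div, Finset.sum_add_distrib]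
      have := hSr i; have := hTr i
      exact mul_le_of_le_one_right (hx0 i) (by linarith)
    have e3 : ∑ i, ∑ j, y j * ((S i j ^ 2 + T i j ^ 2) / 2) ≤ 1 := by
      rw [← hys, Finset.sum_comm]
      refine Finset.sum_le_sum fun j _ => ?_
      rw [← Finset.mul_sum, ← Finset.sum_div, Finset.sum_add_distrib]
      have := hSc j; have := hTc j
      exact mul_le_of_le_one_right (hy0 j) (by linarith)
    have e4 : ∑ i, ∑ j, F i j = 1/p * ∑ i, ∑ j, x i * ((S i j ^ 2 + T i j ^ 2) / 2)
        + 1/q * ∑ i, ∑ j, y j * ((S i j ^ 2 + T i j ^ 2) / 2)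
        - ∑ i, ∑ j, g i j * (S i j * T i j) := by
      simp only [Finset.mul_sum, ← Finset.sum_add_distrib, ← Finset.sum_sub_distrib]
      refine Finset.sum_congr rfl fun i _ => Finset.sum_congr rfl fun j _ => ?_
      simp only [hF]; ring
    rw [e4, e1]
    nlinarith [mul_le_mul_of_nonneg_left e2 hp0.le, mul_le_mul_of_nonneg_left e3 hq0.le]
  have hFz : F i j = 0 := by
    have h1 : ∑ i, ∑ j, F i j = 0 :=
      le_antisymm hsum (Finset.sum_nonneg fun i _ => Finset.sum_nonneg fun j _ => hF0 i j)
    rw [Finset.sum_eq_zero_iff_of_nonneg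
      (fun i _ => Finset.sum_nonneg fun j _ => hF0 i j)] at h1
    have h2 := h1 i (Finset.mem_univ _)
    rw [Finset.sum_eq_zero_iff_of_nonneg (fun j _ => hF0 i j)] at h2
    exact h2 j (Finset.mem_univ _)
  rw [hsplit] at hFz
  have z1 := (add_eq_zero_iff_of_nonneg (hn1 i j) (hn2 i j)).1 hFz
  have hgT : g i j * T i j = g i j * S i j := by
    rcases mul_eq_zero.1 z1.2 with h | h
    · simp [h]
    · have : S i j - T i j = 0 := by
        apply pow_eq_zero_iff (two_ne_zero) |>.1
        linarith
      rw [sub_eq_zero.1 this]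
  have hL : N⁻¹ * (α i * β j * T i j) = g i j * S i j := by rw [← hgT]; simp only [hg]; ring
  rw [hL]
  by_cases hS : S i j = 0
  · simp [hS]
  · have h1 : 1/p * x i + 1/q * y j - g i j = 0 := by
      rcases mul_eq_zero.1 z1.1 with h | h
      · exact h
      · have : 0 < S i j ^ 2 := by positivity
        nlinarith [sq_nonneg (T i j)]
    have h2 : x i = y j := by
      apply amgm_eq hp hq hpq (hx0 i) (hy0 j)
      rw [← hgx]; linarith
    have h3 : g i j = x i := by
      rw [← h2, ← add_mul, hpq, one_mul] at h1
      linarith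
    have h4 : g i j = y j := h3.trans h2
    constructor
    · rw [h3]; simp only [hx]; ring
    · rw [h4]; simp only [hy]; ring

lemma holder_main {m n : ℕ} (A B : Matrix (Fin m) (Fin n) ℝ) (p q a b : ℝ)
    (hp : 1 < p) (hq : 1 < q) (hpq : 1/p + 1/q = 1) (ha : 0 < a) (hb : 0 < b)
    (hsa : trace (matPow (Aᴴ * A) (p/2)) = a) (hsb : trace (matPow (Bᴴ * B) (q/2)) = b)
    (heq : trace (Aᴴ * B) = a ^ (1/p) * b ^ (1/q)) :
    (a ^ (1/p) * b ^ (1/q))⁻¹ • (Aᴴ * B) = a⁻¹ • matPow (Aᴴ * A) (p/2) ∧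
    (a ^ (1/p) * b ^ (1/q))⁻¹ • (Aᴴ * B) = b⁻¹ • matPow (Bᴴ * B) (q/2) := by
  obtain ⟨V, α, U, e, v1, v2, hα, hAe, he, hU, hU', hAp⟩ := svd_exists A
  obtain ⟨W, β, Z, f, w1, w2, hβ, hBe, hf, hZ, hZ', hBp⟩ := svd_exists B
  rw [hAp, trace_conj V v1] at hsa
  rw [hBp, trace_conj W w1] at hsb
  set S := Vᵀ * W with hS
  set T := Uᵀ * Z with hT
  have hAB : Aᴴ * B = V * (diagonal α * T * diagonal β) * Wᵀ := by
    rw [Matrix.conjTranspose_eq_transpose_of_trivial]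
    conv_lhs => rw [hAe, hBe]
    simp only [Matrix.transpose_mul, Matrix.transpose_transpose, Matrix.diagonal_transpose,
      Matrix.mul_assoc, hT]
  have hVS : V * S = W := by rw [hS, ← Matrix.mul_assoc, v2, Matrix.one_mul]
  have hSW : S * Wᵀ = Vᵀ := by rw [hS, Matrix.mul_assoc, w2, Matrix.mul_one]
  have hent : ∀ i j, (diagonal α * T * diagonal β) i j = α i * β j * T i j := fun i j => by
    rw [Matrix.mul_diagonal, Matrix.diagonal_mul]; ring
  have htr : trace (Aᴴ * B) = ∑ i, ∑ j, α i * β j * S i j * T i j := by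
    rw [hAB, Matrix.mul_assoc, Matrix.trace_mul_comm, Matrix.mul_assoc]
    have : Wᵀ * V = Sᵀ := by rw [hS]; simp [Matrix.transpose_mul]
    rw [this, Matrix.trace]
    refine Finset.sum_congr rfl fun i _ => ?_
    rw [Matrix.diag_apply, Matrix.mul_apply]
    refine Finset.sum_congr rfl fun j _ => ?_
    rw [hent, Matrix.transpose_apply]; ring
  have hone : (1 : Matrix (Fin n) (Fin n) ℝ) = diagonal (fun _ => 1) := Matrix.diagonal_one.symm
  have key := termwise α β S T p q a b hp hq hpq ha hb hα hβ
    (bessel_row V W (fun _ => 1) (fun _ => le_rfl) (v1.trans hone) (by rw [w1, Matrix.mul_one]))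
    (fun j => by
      have := bessel_row W V (fun _ => 1) (fun _ => le_rfl) (w1.trans hone)
        (by rw [v1, Matrix.mul_one]) j
      have h : Wᵀ * V = Sᵀ := by rw [hS]; simp [Matrix.transpose_mul]
      rw [h] at this
      exact this)
    (bessel_row U Z e he hU hZ')
    (fun j => by
      have := bessel_row Z U f hf hZ hU' j
      have h : Zᵀ * U = Tᵀ := by rw [hT]; simp [Matrix.transpose_mul]
      rw [h] at this
      exact this)
    hsa hsb (htr ▸ heq)
  have k1 : (a ^ (1/p) * b ^ (1/q))⁻¹ • (diagonal α * T * diagonal β)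
      = a⁻¹ • (diagonal (fun i => α i ^ p) * S) := by
    ext i j
    rw [Matrix.smul_apply, Matrix.smul_apply, hent, Matrix.diagonal_mul]
    exact (key i j).1
  have k2 : (a ^ (1/p) * b ^ (1/q))⁻¹ • (diagonal α * T * diagonal β)
      = b⁻¹ • (S * diagonal (fun i => β i ^ q)) := by
    ext i j
    rw [Matrix.smul_apply, Matrix.smul_apply, hent, Matrix.mul_diagonal, mul_comm (S i j)]
    exact (key i j).2
  constructor
  · rw [hAB, hAp, ← Matrix.smul_mul, ← Matrix.mul_smul, k1, Matrix.mul_smul, Matrix.smul_mul,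
      ← Matrix.mul_assoc, Matrix.mul_assoc _ S, hSW]
  · rw [hAB, hBp, ← Matrix.smul_mul, ← Matrix.mul_smul, k2, Matrix.mul_smul, Matrix.smul_mul,
      ← Matrix.mul_assoc, hVS]

/-- **Equality case in matrix Hölder's inequality** (Theorem 2.12): let m ≤ n,
let A, B be nonzero real m×n matrices, and let p, q ∈ (1,∞) with 1/p+1/q = 1.
Then tr(A^*B) = (tr(|A|^p))^{1/p}(tr(|B|^q))^{1/q} holds iff B^*A is symmetric
positive semidefinite and A^*B = B^*A = c^p (A^*A)^{p/2} = c^{-q} (B^*B)^{q/2}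
for some c > 0; equivalently, iff
A^*B/(‖A‖_p‖B‖_q) = B^*A/(‖A‖_p‖B‖_q) = (A^*A)^{p/2}/tr(|A|^p) = (B^*B)^{q/2}/tr(|B|^q). -/
theorem matrix_holder_equality_case {m n : ℕ} (hmn : m ≤ n)
    (A B : Matrix (Fin m) (Fin n) ℝ) (hA : A ≠ 0) (hB : B ≠ 0)
    (p q : ℝ) (hp : 1 < p) (hq : 1 < q) (hpq : 1/p + 1/q = 1) :
    (Matrix.trace (Aᴴ * B) =
        (Matrix.trace (matPow (matAbs A) p)) ^ (1/p) *
          (Matrix.trace (matPow (matAbs B) q)) ^ (1/q) ↔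
      (Bᴴ * A).PosSemidef ∧ ∃ c : ℝ, 0 < c ∧
        Aᴴ * B = Bᴴ * A ∧
        Bᴴ * A = c ^ p • matPow (Aᴴ * A) (p/2) ∧
        Bᴴ * A = c ^ (-q) • matPow (Bᴴ * B) (q/2)) ∧
    (Matrix.trace (Aᴴ * B) =
        (Matrix.trace (matPow (matAbs A) p)) ^ (1/p) *
          (Matrix.trace (matPow (matAbs B) q)) ^ (1/q) ↔
      ((Matrix.trace (matPow (matAbs A) p)) ^ (1/p) *
          (Matrix.trace (matPow (matAbs B) q)) ^ (1/q))⁻¹ • (Aᴴ * B) =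
        ((Matrix.trace (matPow (matAbs A) p)) ^ (1/p) *
          (Matrix.trace (matPow (matAbs B) q)) ^ (1/q))⁻¹ • (Bᴴ * A) ∧
      ((Matrix.trace (matPow (matAbs A) p)) ^ (1/p) *
          (Matrix.trace (matPow (matAbs B) q)) ^ (1/q))⁻¹ • (Bᴴ * A) =
        (Matrix.trace (matPow (matAbs A) p))⁻¹ • matPow (Aᴴ * A) (p/2) ∧
      (Matrix.trace (matPow (matAbs A) p))⁻¹ • matPow (Aᴴ * A) (p/2) =
        (Matrix.trace (matPow (matAbs B) q))⁻¹ • matPow (Bᴴ * B) (q/2)) := by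
  simp only [matPow_matAbs]
  have ha := trace_pos A hA p (by linarith)
  have hb := trace_pos B hB q (by linarith)
  have hmain := holder_main A B p q _ _ hp hq hpq ha hb rfl rfl
  have hPA := matPow_psd A p
  set a := trace (matPow (Aᴴ * A) (p/2)) with hadef
  set b := trace (matPow (Bᴴ * B) (q/2)) with hbdef
  set N := a ^ (1/p) * b ^ (1/q) with hN
  have hN0 : 0 < N := by positivity
  have hp0 : 0 < p := by linarith
  have hq0 : 0 < q := by linarith
  have hBA : (Aᴴ * B)ᴴ = Bᴴ * A := by simp [Matrix.conjTranspose_mul]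
  have htr : trace (Bᴴ * A) = trace (Aᴴ * B) := by
    rw [← hBA, Matrix.conjTranspose_eq_transpose_of_trivial, Matrix.trace_transpose]
  -- consequences of equality
  have hcons : trace (Aᴴ * B) = N → Aᴴ * B = Bᴴ * A ∧
      Bᴴ * A = (N / a) • matPow (Aᴴ * A) (p/2) ∧ Bᴴ * A = (N / b) • matPow (Bᴴ * B) (q/2) := by
    intro h
    obtain ⟨h1, h2⟩ := hmain h
    have h1' : Aᴴ * B = (N / a) • matPow (Aᴴ * A) (p/2) := by
      rw [div_eq_mul_inv, mul_smul, ← h1, smul_inv_smul₀ hN0.ne']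
    have h2' : Aᴴ * B = (N / b) • matPow (Bᴴ * B) (q/2) := by
      rw [div_eq_mul_inv, mul_smul, ← h2, smul_inv_smul₀ hN0.ne']
    have hsym : Aᴴ * B = Bᴴ * A := by
      rw [← hBA, h1', Matrix.conjTranspose_smul, hPA.isHermitian.eq, star_trivial]
    exact ⟨hsym, hsym ▸ h1', hsym ▸ h2'⟩
  have hq1 : 1/q = 1 - 1/p := by linarith
  constructor
  · constructor
    · intro h
      obtain ⟨h1, h2, h3⟩ := hcons h
      refine ⟨?_, (N / a) ^ (1/p), by positivity, h1, ?_, ?_⟩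
      · rw [h2]
        exact hPA.smul (by positivity)
      · rw [← Real.rpow_mul (by positivity), one_div_mul_cancel hp0.ne', Real.rpow_one]
        exact h2
      · have : ((N / a) ^ (1/p)) ^ (-q) = N / b := by
          have ea : N / a = (b / a) ^ (1/q) := by
            rw [hN, Real.div_rpow hb.le ha.le, div_eq_div_iff ha.ne' (by positivity)]
            have : a = a ^ (1/p) * a ^ (1/q) := by
              rw [← Real.rpow_add ha, hpq, Real.rpow_one]
            nth_rewrite 3 [this]
            ring
          have eb : N / b = (a / b) ^ (1/p) := by
            rw [hN, Real.div_rpow ha.le hb.le, div_eq_div_iff hb.ne' (by positivity)]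
            have : b = b ^ (1/p) * b ^ (1/q) := by
              rw [← Real.rpow_add hb, hpq, Real.rpow_one]
            nth_rewrite 3 [this]
            ring
          rw [ea, eb, ← Real.rpow_mul (by positivity), ← Real.rpow_mul (by positivity),
            ← inv_div b a, Real.inv_rpow (by positivity), ← Real.rpow_neg (by positivity)]
          congr 1
          field_simp
        rw [this]
        exact h3
    · rintro ⟨-, c, hc, h1, h2, h3⟩
      have t2 : trace (Aᴴ * B) = c ^ p * a := by
        rw [h1, h2, Matrix.trace_smul, smul_eq_mul]
      have t3 : trace (Aᴴ * B) = c ^ (-q) * b := by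
        rw [h1, h3, Matrix.trace_smul, smul_eq_mul]
      set t := trace (Aᴴ * B) with ht
      have ht0 : 0 < t := by rw [t2]; positivity
      have ea : a = t * c ^ (-p) := by
        rw [t2, Real.rpow_neg hc.le]; field_simp
      have eb : b = t * c ^ q := by
        rw [t3, Real.rpow_neg hc.le]; field_simp
      rw [hN, ea, eb, Real.mul_rpow ht0.le (by positivity), Real.mul_rpow ht0.le (by positivity),
        ← Real.rpow_mul hc.le, ← Real.rpow_mul hc.le, mul_one_div_cancel hq0.ne',
        neg_mul, mul_one_div_cancel hp0.ne', Real.rpow_neg hc.le, Real.rpow_one]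
      have : t ^ (1/p) * t ^ (1/q) = t := by rw [← Real.rpow_add ht0, hpq, Real.rpow_one]
      calc t = t ^ (1/p) * t ^ (1/q) := this.symm
        _ = _ := by field_simp
  · constructor
    · intro h
      obtain ⟨h1, h2, h3⟩ := hcons h
      obtain ⟨g1, g2⟩ := hmain h
      exact ⟨by rw [h1], by rw [← h1, g1], g1.symm.trans g2⟩
    · rintro ⟨-, h2, -⟩
      have := congrArg trace h2
      rw [Matrix.trace_smul, Matrix.trace_smul, htr, smul_eq_mul, smul_eq_mul, ← hadef,
        inv_mul_cancel₀ ha.ne'] at this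
      field_simp at this
      exact this
end
end

section
/- Let μ be an ℝ^m-valued Borel measure on ℝ^n of finite total variation with μ(ℝ^n) = 0 and finite first moments. Then I(μ) = J(μ). Moreover: (i) there exists a 1-Lipschitz map u₀ : ℝ^n → ℝ^m with J(μ) = ∫⟨u₀, dμ⟩; (ii) there exists a matrix-valued measure M₀ with −div M₀ = μ and I(μ) = ‖M₀‖_𝓜; (iii) J(μ) equals the supremum of ∫⟨f, dμ⟩ over f ∈ C¹₀(ℝ^n, ℝ^m) with ‖f‖_{C¹} ≤ 1; and (iv) if u₀, M₀ are optimisers as in (i), (ii) and u₀ is differentiable ‖M₀‖₁-almost everywhere, then ⟨Du₀, dM₀/d‖M₀‖₁⟩ = 1 holds ‖M₀‖₁-almost everywhere. -/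
open Matrix MeasureTheory Filter
open scoped RealInnerProductSpace Topology

noncomputable section

/-- Euclidean space ℝⁿ. -/
abbrev Euc (n : ℕ) := EuclideanSpace ℝ (Fin n)

/-- Frobenius (trace) pairing ⟨A, B⟩ = tr(AB^*) of two m×n matrices. -/
def frob {m n : ℕ} (A B : Matrix (Fin m) (Fin n) ℝ) : ℝ := Matrix.trace (A * Bᴴ)

/-- The matrix of the Fréchet derivative of f : ℝⁿ → ℝᵐ at x. -/
def fderivMat {n m : ℕ} (f : Euc n → Euc m) (x : Euc n) : Matrix (Fin m) (Fin n) ℝ :=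
  Matrix.of fun i j => fderiv ℝ f x (EuclideanSpace.single j 1) i

/-- f ∈ C¹(ℝⁿ, ℝᵐ): continuously differentiable with bounded derivative. -/
def C1b {n m : ℕ} (f : Euc n → Euc m) : Prop :=
  ContDiff ℝ 1 f ∧ ∃ C : ℝ, ∀ x, ‖fderiv ℝ f x‖ ≤ C

/-- f ∈ C¹₀(ℝⁿ, ℝᵐ): continuously differentiable with derivative vanishing at
infinity. -/
def C1z {n m : ℕ} (f : Euc n → Euc m) : Prop :=
  ContDiff ℝ 1 f ∧ Tendsto (fun x => ‖fderiv ℝ f x‖) (cocompact (Euc n)) (nhds 0)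

/-- The C¹ seminorm ‖f‖_{C¹} = sup_x ‖Df(x)‖ (operator norm). -/
def C1Norm {n m : ℕ} (f : Euc n → Euc m) : ℝ := ⨆ x, ‖fderiv ℝ f x‖

/-- An ℝᵐ-valued Borel measure μ on ℝⁿ of finite total variation, encoded by its
total variation measure `var = ‖μ‖` together with its polar (Radon–Nikodym)
density `density = dμ/d‖μ‖`, a vector field of norm one ‖μ‖-a.e.; thus
μ(E) = ∫_E density d‖μ‖. -/
structure VecMeas (n m : ℕ) where
  var : Measure (Euc n)
  density : Euc n → Euc m
  finite : IsFiniteMeasure var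
  measurable_density : Measurable density
  norm_density : ∀ᵐ x ∂var, ‖density x‖ = 1

/-- The pairing ∫ ⟨f, dμ⟩. -/
def VecMeas.pair {n m : ℕ} (μ : VecMeas n m) (f : Euc n → Euc m) : ℝ :=
  ∫ x, ⟪f x, μ.density x⟫ ∂μ.var

/-- μ(ℝⁿ) = 0. -/
def VecMeas.totalZero {n m : ℕ} (μ : VecMeas n m) : Prop :=
  ∫ x, μ.density x ∂μ.var = 0

/-- Finite first moments: ∫ ‖x‖ d‖μ‖(x) < ∞. -/
def VecMeas.finiteFirstMoment {n m : ℕ} (μ : VecMeas n m) : Prop :=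
  Integrable (fun x => ‖x‖) μ.var

/-- An ℝ^{m×n}-valued Borel measure M on ℝⁿ of finite total variation with
respect to the Schatten 1-norm, encoded by its total variation measure
`var = ‖M‖₁` together with its Radon–Nikodym density `density = dM/d‖M‖₁`,
a matrix field of Schatten 1-norm one ‖M‖₁-a.e. -/
structure MatMeas (n m : ℕ) where
  var : Measure (Euc n)
  density : Euc n → Matrix (Fin m) (Fin n) ℝ
  finite : IsFiniteMeasure var
  measurable_density : ∀ i j, Measurable fun x => density x i j
  norm_density : ∀ᵐ x ∂var, Matrix.trace (matAbs (density x)) = 1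

/-- The total variation norm ‖M‖_𝓜 = ‖M‖₁(ℝⁿ). -/
def MatMeas.tvNorm {n m : ℕ} (M : MatMeas n m) : ℝ := (M.var Set.univ).toReal

/-- The pairing ∫ ⟨G, dM⟩ of a matrix field G against M. -/
def MatMeas.pair {n m : ℕ} (M : MatMeas n m) (G : Euc n → Matrix (Fin m) (Fin n) ℝ) : ℝ :=
  ∫ x, frob (G x) (M.density x) ∂M.var

/-- −div M = μ: for all f ∈ C¹₀(ℝⁿ, ℝᵐ), ∫⟨f, dμ⟩ = ∫⟨Df, dM⟩. -/
def IsNegDiv {n m : ℕ} (M : MatMeas n m) (μ : VecMeas n m) : Prop :=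
  ∀ f : Euc n → Euc m, C1z f → μ.pair f = M.pair (fderivMat f)

/-- J(μ) = sup { ∫⟨u, dμ⟩ : u ∈ C¹(ℝⁿ,ℝᵐ), ‖u‖_{C¹} ≤ 1 }. -/
def Jsup {n m : ℕ} (μ : VecMeas n m) : ℝ :=
  sSup {r | ∃ f : Euc n → Euc m, C1b f ∧ C1Norm f ≤ 1 ∧ r = μ.pair f}

/-- I(μ) = inf { ‖M‖_𝓜 : −div M = μ }. -/
def Iinf {n m : ℕ} (μ : VecMeas n m) : ℝ :=
  sInf {r | ∃ M : MatMeas n m, IsNegDiv M μ ∧ r = M.tvNorm}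



/-- matrix of a continuous linear map -/
def matOf {n m : ℕ} (L : Euc n →L[ℝ] Euc m) : Matrix (Fin m) (Fin n) ℝ :=
  Matrix.of fun i j => L (EuclideanSpace.single j 1) i

/-- the linear map of a matrix -/
def linOf {n m : ℕ} (A : Matrix (Fin m) (Fin n) ℝ) : Euc n →L[ℝ] Euc m :=
  LinearMap.toContinuousLinearMap (Matrix.toLpLin 2 2 A)

lemma linOf_apply {n m : ℕ} (A : Matrix (Fin m) (Fin n) ℝ) (x : Euc n) (i : Fin m) :
    linOf A x i = ∑ j, A i j * x j := by
  simp [linOf, Matrix.toLpLin_apply, Matrix.mulVec, dotProduct]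

lemma fderivMat_eq {n m : ℕ} (f : Euc n → Euc m) (x : Euc n) :
    fderivMat f x = matOf (fderiv ℝ f x) := rfl

lemma frob_eq_sum {n m : ℕ} (A B : Matrix (Fin m) (Fin n) ℝ) :
    frob A B = ∑ i, ∑ j, A i j * B i j := by
  simp [frob, Matrix.trace, Matrix.mul_apply]

lemma frob_matOf {n m : ℕ} (L : Euc n →L[ℝ] Euc m) (A : Matrix (Fin m) (Fin n) ℝ)
    (b : OrthonormalBasis (Fin n) ℝ (Euc n)) :
    frob (matOf L) A = ∑ k, ⟪L (b k), linOf A (b k)⟫ := by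
  have key : ∀ c : OrthonormalBasis (Fin n) ℝ (Euc n),
      ∑ k, ⟪L (c k), linOf A (c k)⟫ =
        LinearMap.trace ℝ (Euc n) ((ContinuousLinearMap.adjoint L) ∘L (linOf A) : Euc n →L[ℝ] Euc n) := by
    intro c
    rw [LinearMap.trace_eq_sum_inner _ c]
    refine Finset.sum_congr rfl fun k _ => ?_
    simp [ContinuousLinearMap.adjoint_inner_right]
  rw [key b, ← key (EuclideanSpace.basisFun (Fin n) ℝ), frob_eq_sum, Finset.sum_comm]
  refine Finset.sum_congr rfl fun k _ => ?_
  simp [PiLp.inner_apply, matOf, linOf_apply, mul_comm]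

lemma linOf_inner {n m : ℕ} (A : Matrix (Fin m) (Fin n) ℝ) (x y : Euc n) :
    ⟪linOf A x, linOf A y⟫ = ⟪x, linOf (Aᴴ * A) y⟫ := by
  have h1 : linOf (Aᴴ * A) y = linOf Aᴴ (linOf A y) := by
    simp [linOf, Matrix.toLpLin_apply]
  have h2 : ∀ z : Euc m, ⟪linOf A x, z⟫ = ⟪x, linOf Aᴴ z⟫ := by
    intro z
    simp only [PiLp.inner_apply, linOf_apply, RCLike.inner_apply, conj_trivial,
      Finset.sum_mul, Finset.mul_sum, Matrix.conjTranspose_apply, star_trivial]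
    rw [Finset.sum_comm]
    refine Finset.sum_congr rfl fun i _ => Finset.sum_congr rfl fun j _ => by ring
  rw [h1, h2]

/-- The trace norm -/
def trN {n m : ℕ} (A : Matrix (Fin m) (Fin n) ℝ) : ℝ := Matrix.trace (matAbs A)

lemma exists_basis {n m : ℕ} (A : Matrix (Fin m) (Fin n) ℝ) :
    ∃ b : OrthonormalBasis (Fin n) ℝ (Euc n), trN A = ∑ k, ‖linOf A (b k)‖ ∧
      ∀ i j, i ≠ j → ⟪linOf A (b i), linOf A (b j)⟫ = 0 := by
  have hA : (Aᴴ * A).IsHermitian := Matrix.isHermitian_conjTranspose_mul_self A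
  have hin : ∀ i j, ⟪linOf A (hA.eigenvectorBasis i), linOf A (hA.eigenvectorBasis j)⟫ =
      hA.eigenvalues j * ⟪hA.eigenvectorBasis i, hA.eigenvectorBasis j⟫ := by
    intro i j
    rw [linOf_inner]
    have : linOf (Aᴴ * A) (hA.eigenvectorBasis j) = hA.eigenvalues j • hA.eigenvectorBasis j := by
      have := hA.mulVec_eigenvectorBasis j
      ext k
      simpa [linOf, Matrix.toLpLin_apply] using congrFun this k
    rw [this, inner_smul_right]
  refine ⟨hA.eigenvectorBasis, ?_, ?_⟩
  · rw [trN, matAbs, matPow, dif_pos hA, Matrix.trace_mul_cycle]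
    have : (↑(star hA.eigenvectorUnitary) : Matrix (Fin n) (Fin n) ℝ) *
        (hA.eigenvectorUnitary : Matrix (Fin n) (Fin n) ℝ) = 1 := by
      simp
    rw [this, one_mul, Matrix.trace_diagonal]
    refine Finset.sum_congr rfl fun k _ => ?_
    have h := hin k k
    rw [real_inner_self_eq_norm_sq, real_inner_self_eq_norm_sq, OrthonormalBasis.norm_eq_one] at h
    rw [← Real.sqrt_eq_rpow, ← Real.sqrt_sq (norm_nonneg (linOf A _)), h]
    simp
  · intro i j hij
    rw [hin, hA.eigenvectorBasis.orthonormal.2 hij, mul_zero]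

lemma frob_le_trN {n m : ℕ} (L : Euc n →L[ℝ] Euc m) (A : Matrix (Fin m) (Fin n) ℝ) :
    |frob (matOf L) A| ≤ ‖L‖ * trN A := by
  obtain ⟨b, hb, -⟩ := exists_basis A
  rw [frob_matOf L A b, hb, Finset.mul_sum]
  refine (Finset.abs_sum_le_sum_abs _ _).trans (Finset.sum_le_sum fun k _ => ?_)
  refine (abs_real_inner_le_norm _ _).trans ?_
  gcongr
  simpa using L.le_opNorm (b k)

lemma exists_polar {n m : ℕ} (A : Matrix (Fin m) (Fin n) ℝ) :
    ∃ L : Euc n →L[ℝ] Euc m, ‖L‖ ≤ 1 ∧ frob (matOf L) A = trN A := by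
  obtain ⟨b, hb, ho⟩ := exists_basis A
  let f : Fin n → Euc m := fun k => ‖linOf A (b k)‖⁻¹ • linOf A (b k)
  let L : Euc n →L[ℝ] Euc m := ∑ k, (innerSL ℝ (b k)).smulRight (f k)
  have hL : ∀ x, L x = ∑ k, ⟪b k, x⟫ • f k := by
    intro x; simp [L]
  have hf1 : ∀ k, ‖f k‖ ≤ 1 := by
    intro k
    simp only [f, norm_smul, norm_inv, norm_norm]
    exact inv_mul_le_one
  have hfo : ∀ i j, i ≠ j → ⟪f i, f j⟫ = 0 := by
    intro i j hij
    simp [f, inner_smul_left, inner_smul_right, ho i j hij]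
  refine ⟨L, ?_, ?_⟩
  · refine L.opNorm_le_bound zero_le_one fun x => ?_
    rw [one_mul]
    refine le_of_sq_le_sq ?_ (norm_nonneg _)
    rw [← b.sum_sq_norm_inner_right x, ← real_inner_self_eq_norm_sq, hL, sum_inner]
    refine Finset.sum_le_sum fun i _ => ?_
    rw [inner_sum, Finset.sum_eq_single i]
    · rw [inner_smul_left, inner_smul_right, real_inner_self_eq_norm_sq]
      have : ‖f i‖ ^ 2 ≤ 1 := by
        have := hf1 i; have := norm_nonneg (f i); nlinarith
      rw [Real.norm_eq_abs, sq_abs]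
      simp only [conj_trivial]
      nlinarith [sq_nonneg ⟪b i, x⟫]
    · intro j _ hj
      rw [inner_smul_left, inner_smul_right, hfo i j hj.symm]; simp
    · simp
  · rw [frob_matOf L A b, hb]
    refine Finset.sum_congr rfl fun k _ => ?_
    have : L (b k) = f k := by
      rw [hL, Finset.sum_eq_single k]
      · simp
      · intro j _ hj
        rw [b.orthonormal.2 hj, zero_smul]
      · simp
    rw [this]
    simp only [f]
    rw [inner_smul_left, real_inner_self_eq_norm_sq]
    rcases eq_or_ne (‖linOf A (b k)‖) 0 with h | h
    · simp [h]
    · simp; field_simp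

lemma trN_nonneg {n m : ℕ} (A : Matrix (Fin m) (Fin n) ℝ) : 0 ≤ trN A := by
  obtain ⟨b, hb, -⟩ := exists_basis A
  rw [hb]; positivity

lemma frob_smul_right {n m : ℕ} (c : ℝ) (B A : Matrix (Fin m) (Fin n) ℝ) :
    frob B (c • A) = c * frob B A := by
  simp only [frob_eq_sum, Finset.mul_sum, Matrix.smul_apply, smul_eq_mul]
  refine Finset.sum_congr rfl fun i _ => Finset.sum_congr rfl fun j _ => by ring

lemma frob_sub_right {n m : ℕ} (B A A' : Matrix (Fin m) (Fin n) ℝ) :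
    frob B (A - A') = frob B A - frob B A' := by
  simp only [frob_eq_sum, Matrix.sub_apply, mul_sub, Finset.sum_sub_distrib]

lemma frob_le_of_norm_le {n m : ℕ} {L : Euc n →L[ℝ] Euc m} (hL : ‖L‖ ≤ 1)
    (A : Matrix (Fin m) (Fin n) ℝ) : frob (matOf L) A ≤ trN A := by
  have h1 := (le_abs_self _).trans (frob_le_trN L A)
  have h2 := trN_nonneg A
  nlinarith

lemma trN_smul {n m : ℕ} {c : ℝ} (hc : 0 ≤ c) (A : Matrix (Fin m) (Fin n) ℝ) :
    trN (c • A) = c * trN A := by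
  apply le_antisymm
  · obtain ⟨L, hL, h⟩ := exists_polar (c • A)
    rw [← h, frob_smul_right]
    exact mul_le_mul_of_nonneg_left (frob_le_of_norm_le hL A) hc
  · obtain ⟨L, hL, h⟩ := exists_polar A
    rw [← h, ← frob_smul_right]
    exact frob_le_of_norm_le hL _

lemma abs_matOf_le {n m : ℕ} (L : Euc n →L[ℝ] Euc m) (i : Fin m) (j : Fin n) :
    |matOf L i j| ≤ ‖L‖ := by
  have h := PiLp.norm_apply_le (L (EuclideanSpace.single j 1)) i
  refine h.trans ((L.le_opNorm _).trans ?_)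
  simp

lemma trN_eq_zero {n m : ℕ} {A : Matrix (Fin m) (Fin n) ℝ} (h : trN A = 0) : A = 0 := by
  have h0 : ∀ L, frob (matOf L) A = 0 := by
    intro L
    have := frob_le_trN L A
    rw [h, mul_zero] at this
    exact abs_nonpos_iff.mp this
  have h1 := h0 (linOf A)
  have : matOf (linOf A) = A := by
    ext i j; simp [matOf, linOf_apply]
  rw [this, frob_eq_sum] at h1
  have h3 : ∀ i ∈ Finset.univ, (0:ℝ) ≤ ∑ j, A i j * A i j :=
    fun i _ => Finset.sum_nonneg fun j _ => mul_self_nonneg _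
  ext i j
  have h2 := (Finset.sum_eq_zero_iff_of_nonneg h3).1 h1 i (Finset.mem_univ _)
  have h4 : ∀ j ∈ Finset.univ, (0:ℝ) ≤ A i j * A i j := fun j _ => mul_self_nonneg _
  have h5 := (Finset.sum_eq_zero_iff_of_nonneg h4).1 h2 j (Finset.mem_univ _)
  simpa using h5

lemma trN_sub_le {n m : ℕ} (A B : Matrix (Fin m) (Fin n) ℝ) :
    trN A - trN B ≤ ∑ i, ∑ j, |A i j - B i j| := by
  obtain ⟨L, hL, h⟩ := exists_polar A
  have h1 := frob_le_of_norm_le hL B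
  rw [← h]
  calc frob (matOf L) A - trN B ≤ frob (matOf L) (A - B) := by rw [frob_sub_right]; linarith
    _ ≤ _ := by
      rw [frob_eq_sum]
      refine Finset.sum_le_sum fun i _ => Finset.sum_le_sum fun j _ => ?_
      refine (le_abs_self _).trans ?_
      rw [abs_mul, Matrix.sub_apply]
      have := (abs_matOf_le L i j).trans hL
      nlinarith [abs_nonneg (A i j - B i j)]

lemma continuous_trN {n m : ℕ} :
    Continuous (fun a : Fin m → Fin n → ℝ => trN (Matrix.of a)) := by
  rw [continuous_iff_continuousAt]
  intro a
  have h : Tendsto (fun b : Fin m → Fin n → ℝ => ∑ i, ∑ j, |b i j - a i j|) (𝓝 a) (𝓝 0) := by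
    have : Continuous (fun b : Fin m → Fin n → ℝ => ∑ i, ∑ j, |b i j - a i j|) := by fun_prop
    simpa using this.tendsto a
  rw [ContinuousAt, tendsto_iff_norm_sub_tendsto_zero]
  refine squeeze_zero (fun _ => norm_nonneg _) (fun b => ?_) h
  rw [Real.norm_eq_abs, abs_le]
  constructor
  · have := trN_sub_le (Matrix.of a) (Matrix.of b)
    simp only [Matrix.of_apply] at this
    simp_rw [abs_sub_comm (b _ _)]
    linarith
  · exact trN_sub_le (Matrix.of b) (Matrix.of a)

lemma measurable_trN {n m : ℕ} {α : Type*} [MeasurableSpace α] {h : α → Matrix (Fin m) (Fin n) ℝ}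
    (hh : ∀ i j, Measurable fun x => h x i j) : Measurable fun x => trN (h x) := by
  have : Measurable (fun x => (fun i j => h x i j : Fin m → Fin n → ℝ)) :=
    measurable_pi_iff.2 fun i => measurable_pi_iff.2 fun j => hh i j
  exact continuous_trN.measurable.comp this


lemma C1z.bdd {n m : ℕ} {f : Euc n → Euc m} (hf : C1z f) : ∃ C : ℝ, ∀ x, ‖fderiv ℝ f x‖ ≤ C := by
  have hc : Continuous (fderiv ℝ f) := hf.1.continuous_fderiv one_ne_zero
  have h1 := hf.2.eventually (gt_mem_nhds (zero_lt_one (α := ℝ)))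
  obtain ⟨K, hK, hK2⟩ := mem_cocompact.1 h1
  obtain ⟨C, hC⟩ := hK.exists_bound_of_continuousOn hc.continuousOn
  refine ⟨max C 1, fun x => ?_⟩
  by_cases hx : x ∈ K
  · exact (hC x hx).trans (le_max_left _ _)
  · exact (le_of_lt (hK2 hx)).trans (le_max_right _ _)

lemma C1z.c1b {n m : ℕ} {f : Euc n → Euc m} (hf : C1z f) : C1b f := ⟨hf.1, hf.bdd⟩

lemma C1b.norm_le {n m : ℕ} {f : Euc n → Euc m} (hf : C1b f) (h : C1Norm f ≤ 1) (x : Euc n) :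
    ‖fderiv ℝ f x‖ ≤ 1 := by
  obtain ⟨C, hC⟩ := hf.2
  refine le_trans (le_ciSup (f := fun x => ‖fderiv ℝ f x‖) ⟨C, ?_⟩ x) h
  rintro _ ⟨y, rfl⟩
  exact hC y

lemma C1Norm_le {n m : ℕ} {f : Euc n → Euc m} (h : ∀ x, ‖fderiv ℝ f x‖ ≤ 1) : C1Norm f ≤ 1 :=
  ciSup_le h

lemma lip_of_fderiv {n m : ℕ} {f : Euc n → Euc m} (hf : ContDiff ℝ 1 f) {C : ℝ} (hC : 0 ≤ C)
    (h : ∀ x, ‖fderiv ℝ f x‖ ≤ C) : LipschitzWith C.toNNReal f := by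
  refine lipschitzWith_of_nnnorm_fderiv_le (hf.differentiable one_ne_zero) fun x => ?_
  rw [← NNReal.coe_le_coe, Real.coe_toNNReal _ hC]
  exact h x

lemma lip_one {n m : ℕ} {f : Euc n → Euc m} (hf : ContDiff ℝ 1 f)
    (h : ∀ x, ‖fderiv ℝ f x‖ ≤ 1) : LipschitzWith 1 f := by
  simpa using lip_of_fderiv hf zero_le_one h

lemma lip_bound {n m : ℕ} {f : Euc n → Euc m} {C : NNReal} (hf : LipschitzWith C f) (x : Euc n) :
    ‖f x‖ ≤ ‖f 0‖ + C * ‖x‖ := by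
  have := hf.dist_le_mul x 0
  rw [dist_eq_norm, dist_zero_right] at this
  have h2 := norm_add_le (f 0) (f x - f 0)
  rw [add_sub_cancel] at h2
  linarith

lemma integrable_pair {n m : ℕ} (μ : VecMeas n m) (hmom : μ.finiteFirstMoment)
    {f : Euc n → Euc m} {C : NNReal} (hf : LipschitzWith C f) :
    Integrable (fun x => ⟪f x, μ.density x⟫) μ.var := by
  have := μ.finite
  refine Integrable.mono' (g := fun x => ‖f 0‖ + C * ‖x‖)
    ((integrable_const _).add (hmom.const_mul _)) ?_ ?_
  · exact (hf.continuous.measurable.inner μ.measurable_density).aestronglyMeasurable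
  · filter_upwards [μ.norm_density] with x hx
    refine (norm_inner_le_norm _ _).trans ?_
    rw [hx, mul_one]; exact lip_bound hf x

lemma integrable_density {n m : ℕ} (μ : VecMeas n m) : Integrable μ.density μ.var := by
  have := μ.finite
  refine Integrable.mono' (g := fun _ => 1) (integrable_const _)
    μ.measurable_density.aestronglyMeasurable ?_
  filter_upwards [μ.norm_density] with x hx using hx.le

lemma pair_const {n m : ℕ} (μ : VecMeas n m) (hzero : μ.totalZero) (c : Euc m) :
    μ.pair (fun _ => c) = 0 := by
  rw [VecMeas.pair, integral_inner (integrable_density μ), hzero, inner_zero_right]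

lemma pair_sub_const {n m : ℕ} (μ : VecMeas n m) (hzero : μ.totalZero)
    (hmom : μ.finiteFirstMoment)
    {f : Euc n → Euc m} {C : NNReal} (hf : LipschitzWith C f) (c : Euc m) :
    μ.pair (fun x => f x - c) = μ.pair f := by
  have h := pair_const μ hzero c
  rw [VecMeas.pair] at h ⊢
  simp_rw [inner_sub_left]
  rw [integral_sub (integrable_pair μ hmom hf)
    (integrable_pair μ hmom (LipschitzWith.const' (K := 0) c)), h, sub_zero, VecMeas.pair]

lemma pair_le {n m : ℕ} (μ : VecMeas n m) (hzero : μ.totalZero) (hmom : μ.finiteFirstMoment)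
    {f : Euc n → Euc m} (hf : LipschitzWith 1 f) : μ.pair f ≤ ∫ x, ‖x‖ ∂μ.var := by
  rw [← pair_sub_const μ hzero hmom hf (f 0), VecMeas.pair]
  have hf' : LipschitzWith 1 (fun x => f x - f 0) := by
    simpa using hf.sub (LipschitzWith.const' (K := 0) (f 0))
  refine integral_mono_ae (integrable_pair μ hmom hf') hmom ?_
  filter_upwards [μ.norm_density] with x hx
  refine (real_inner_le_norm _ _).trans ?_
  rw [hx, mul_one]
  simpa using lip_bound hf' x

lemma pair_tendsto {n m : ℕ} (μ : VecMeas n m) (hmom : μ.finiteFirstMoment)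
    {u : ℕ → Euc n → Euc m} {v : Euc n → Euc m} (hu : ∀ k, LipschitzWith 1 (u k))
    (h : ∀ x, Tendsto (fun k => u k x) atTop (𝓝 (v x))) :
    Tendsto (fun k => μ.pair (u k)) atTop (𝓝 (μ.pair v)) := by
  have := μ.finite
  obtain ⟨C, hC⟩ := (h 0).norm.bddAbove_range
  refine tendsto_integral_of_dominated_convergence (fun x => C + ‖x‖)
    (fun k => (integrable_pair μ hmom (hu k)).1) ((integrable_const _).add hmom) ?_ ?_
  · intro k
    filter_upwards [μ.norm_density] with x hx
    refine (norm_inner_le_norm _ _).trans ?_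
    rw [hx, mul_one]
    have h1 := lip_bound (hu k) x
    have h2 : ‖u k 0‖ ≤ C := hC ⟨k, rfl⟩
    simp at h1; linarith
  · exact Eventually.of_forall fun x => (h x).inner tendsto_const_nhds

/-- the squashing map -/
def sqz {n : ℕ} (y : Euc n) : Euc n := (√(1 + ‖y‖ ^ 2))⁻¹ • y

lemma sqz_contDiff {n : ℕ} : ContDiff ℝ 1 (sqz : Euc n → Euc n) := by
  unfold sqz
  have h : ∀ y : Euc n, (1 + ‖y‖ ^ 2) ≠ 0 := fun y => by positivity
  refine ContDiff.smul (ContDiff.inv (ContDiff.sqrt (contDiff_const.add (contDiff_norm_sq ℝ)) h)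
    fun y => ?_) contDiff_id
  positivity

lemma sqz_hasFDerivAt {n : ℕ} (y : Euc n) : ∃ L : Euc n →L[ℝ] Euc n, HasFDerivAt sqz L y ∧
    ∀ v, L v = (√(1 + ‖y‖ ^ 2))⁻¹ • v - ((√(1 + ‖y‖ ^ 2))⁻¹ ^ 3 * ⟪y, v⟫) • y := by
  have hp : 0 < 1 + ‖y‖ ^ 2 := by positivity
  have h1 : HasFDerivAt (fun y : Euc n => 1 + ‖y‖ ^ 2) _ y := ((hasFDerivAt_id y).norm_sq).const_add 1
  have h2 := (Real.hasDerivAt_sqrt hp.ne').inv (Real.sqrt_pos.2 hp).ne'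
  have h3 := (h2.comp_hasFDerivAt y h1).smul (hasFDerivAt_id y)
  refine ⟨_, h3, fun v => ?_⟩
  have hs := (Real.sqrt_pos.2 hp).ne'
  simp [sub_eq_add_neg, ← neg_smul]
  congr 1
  field_simp

lemma sqz_fderiv_le {n : ℕ} (y : Euc n) : ‖fderiv ℝ sqz y‖ ≤ (√(1 + ‖y‖ ^ 2))⁻¹ := by
  obtain ⟨L, hL, h⟩ := sqz_hasFDerivAt y
  rw [hL.fderiv]
  set s := (√(1 + ‖y‖ ^ 2))⁻¹ with hs
  have hs0 : 0 ≤ s := by positivity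
  have hs2 : s ^ 2 * (1 + ‖y‖ ^ 2) = 1 := by
    rw [hs, inv_pow, Real.sq_sqrt (by positivity)]; field_simp
  refine L.opNorm_le_bound hs0 fun v => ?_
  refine le_of_sq_le_sq ?_ (by positivity)
  rw [h, norm_sub_sq_real, inner_smul_left, inner_smul_right, real_inner_comm, norm_smul, norm_smul,
    Real.norm_eq_abs, Real.norm_eq_abs, mul_pow, mul_pow, sq_abs, sq_abs]
  simp only [conj_trivial, mul_pow]
  rw [real_inner_comm]
  have e : (s ^ 2 * ‖v‖ ^ 2 - 2 * (s * (s ^ 3 * ⟪y, v⟫ * ⟪y, v⟫)) + (s ^ 3) ^ 2 * ⟪y, v⟫ ^ 2 * ‖y‖ ^ 2)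
    = s ^ 2 * ‖v‖ ^ 2 - (s ^ 2 * ⟪y, v⟫) ^ 2 * (2 - s ^ 2 * ‖y‖ ^ 2) := by ring
  rw [e]
  have : s ^ 2 * ‖y‖ ^ 2 ≤ 1 := by nlinarith [sq_nonneg s]
  nlinarith [sq_nonneg (s ^ 2 * ⟪y, v⟫)]

lemma sqz_fderiv_zero {n : ℕ} : fderiv ℝ (sqz : Euc n → Euc n) 0 = ContinuousLinearMap.id ℝ _ := by
  obtain ⟨L, hL, h⟩ := sqz_hasFDerivAt (0 : Euc n)
  rw [hL.fderiv]
  ext v i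
  simp [h]

/-- rescaled squashing maps -/
def sqk {n : ℕ} (k : ℕ) (x : Euc n) : Euc n := ((k : ℝ) + 1) • sqz (((k : ℝ) + 1)⁻¹ • x)

lemma sqk_contDiff {n : ℕ} (k : ℕ) : ContDiff ℝ 1 (sqk k : Euc n → Euc n) := by
  unfold sqk
  exact (sqz_contDiff.comp (contDiff_id.const_smul _)).const_smul _

lemma sqk_fderiv {n : ℕ} (k : ℕ) (x : Euc n) :
    fderiv ℝ (sqk k) x = fderiv ℝ sqz (((k : ℝ) + 1)⁻¹ • x) := by
  have hk : ((k : ℝ) + 1) ≠ 0 := by positivity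
  have h1 := (sqz_contDiff.differentiable one_ne_zero (((k : ℝ) + 1)⁻¹ • x)).hasFDerivAt
  have h2 : HasFDerivAt (fun x : Euc n => ((k : ℝ) + 1)⁻¹ • x)
    (((k : ℝ) + 1)⁻¹ • ContinuousLinearMap.id ℝ (Euc n)) x :=
    (hasFDerivAt_id x).const_smul (((k : ℝ) + 1)⁻¹)
  have h3 := (h1.comp x h2).const_smul ((k : ℝ) + 1)
  have h4 : HasFDerivAt (sqk k) _ x := h3
  rw [h4.fderiv]
  ext v i
  simp [hk]

lemma tendsto_scale {n : ℕ} (x : Euc n) :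
    Tendsto (fun k : ℕ => ((k : ℝ) + 1)⁻¹ • x) atTop (𝓝 0) := by
  have : Tendsto (fun k : ℕ => ((k : ℝ) + 1)⁻¹) atTop (𝓝 0) := by
    simpa using tendsto_one_div_add_atTop_nhds_zero_nat (𝕜 := ℝ)
  simpa using this.smul_const x

lemma sqk_fderiv_tendsto {n : ℕ} (x : Euc n) :
    Tendsto (fun k => fderiv ℝ (sqk k) x) atTop (𝓝 (ContinuousLinearMap.id ℝ (Euc n))) := by
  simp_rw [sqk_fderiv]
  rw [← sqz_fderiv_zero]
  exact ((sqz_contDiff.continuous_fderiv one_ne_zero).tendsto 0).comp (tendsto_scale x)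

lemma sqk_tendsto {n : ℕ} (x : Euc n) : Tendsto (fun k => sqk k x) atTop (𝓝 x) := by
  have h : ∀ k : ℕ, sqk k x = (√(1 + ‖((k : ℝ) + 1)⁻¹ • x‖ ^ 2))⁻¹ • x := by
    intro k
    have hk : ((k : ℝ) + 1) ≠ 0 := by positivity
    rw [sqk, sqz, smul_comm, smul_smul ((k : ℝ) + 1), mul_inv_cancel₀ hk, one_smul]
  simp_rw [h]
  have h1 : Tendsto (fun k : ℕ => (√(1 + ‖((k : ℝ) + 1)⁻¹ • x‖ ^ 2))⁻¹) atTop (𝓝 1) := by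
    have : ContinuousAt (fun y : Euc n => (√(1 + ‖y‖ ^ 2))⁻¹) 0 := by
      refine ContinuousAt.inv₀ (by fun_prop) ?_
      positivity
    have := this.tendsto.comp (tendsto_scale x)
    simpa [Function.comp_def] using this
  simpa using h1.smul_const x

lemma sqk_fderiv_le {n : ℕ} (k : ℕ) (x : Euc n) : ‖fderiv ℝ (sqk k) x‖ ≤ 1 := by
  rw [sqk_fderiv]
  refine (sqz_fderiv_le _).trans (inv_le_one_of_one_le₀ ?_)
  rw [Real.one_le_sqrt]; nlinarith [sq_nonneg ‖((k : ℝ) + 1)⁻¹ • x‖]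

lemma sqk_fderiv_cocompact {n : ℕ} (k : ℕ) :
    Tendsto (fun x : Euc n => ‖fderiv ℝ (sqk k) x‖) (cocompact (Euc n)) (𝓝 0) := by
  have hk : 0 < ((k : ℝ) + 1)⁻¹ := by positivity
  refine squeeze_zero (g := fun x : Euc n => (√(1 + ‖((k : ℝ) + 1)⁻¹ • x‖ ^ 2))⁻¹)
    (fun _ => norm_nonneg _) (fun x => ?_) ?_
  · rw [sqk_fderiv]
    exact sqz_fderiv_le _
  · refine tendsto_inv_atTop_zero.comp (tendsto_atTop_mono (fun x => ?_)
      ((tendsto_norm_cocompact_atTop).const_mul_atTop hk))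
    refine Real.le_sqrt_of_sq_le ?_
    rw [norm_smul, Real.norm_of_nonneg hk.le]
    linarith

lemma comp_sqk_fderiv {n m : ℕ} {u : Euc n → Euc m} (hu : ContDiff ℝ 1 u) (k : ℕ) (x : Euc n) :
    fderiv ℝ (u ∘ sqk k) x = (fderiv ℝ u (sqk k x)) ∘L (fderiv ℝ (sqk k) x) :=
  fderiv_comp x (hu.differentiable one_ne_zero _) ((sqk_contDiff k).differentiable one_ne_zero _)

lemma comp_sqk_le {n m : ℕ} {u : Euc n → Euc m} (hu : ContDiff ℝ 1 u)
    (h : ∀ x, ‖fderiv ℝ u x‖ ≤ 1) (k : ℕ) (x : Euc n) :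
    ‖fderiv ℝ (u ∘ sqk k) x‖ ≤ ‖fderiv ℝ (sqk k) x‖ := by
  rw [comp_sqk_fderiv hu]
  refine (ContinuousLinearMap.opNorm_comp_le _ _).trans ?_
  exact mul_le_of_le_one_left (norm_nonneg _) (h _)

lemma comp_sqk_C1z {n m : ℕ} {u : Euc n → Euc m} (hu : ContDiff ℝ 1 u)
    (h : ∀ x, ‖fderiv ℝ u x‖ ≤ 1) (k : ℕ) : C1z (u ∘ sqk k) :=
  ⟨hu.comp (sqk_contDiff k),
    squeeze_zero (fun _ => norm_nonneg _) (comp_sqk_le hu h k) (sqk_fderiv_cocompact k)⟩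

lemma comp_sqk_le_one {n m : ℕ} {u : Euc n → Euc m} (hu : ContDiff ℝ 1 u)
    (h : ∀ x, ‖fderiv ℝ u x‖ ≤ 1) (k : ℕ) (x : Euc n) : ‖fderiv ℝ (u ∘ sqk k) x‖ ≤ 1 :=
  (comp_sqk_le hu h k x).trans (sqk_fderiv_le k x)

lemma comp_sqk_pair {n m : ℕ} (μ : VecMeas n m) (hmom : μ.finiteFirstMoment)
    {u : Euc n → Euc m} (hu : ContDiff ℝ 1 u) (h : ∀ x, ‖fderiv ℝ u x‖ ≤ 1) :
    Tendsto (fun k => μ.pair (u ∘ sqk k)) atTop (𝓝 (μ.pair u)) := by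
  refine pair_tendsto μ hmom (fun k => lip_one (comp_sqk_C1z hu h k).1 (comp_sqk_le_one hu h k)) ?_
  intro x
  exact (hu.continuous.tendsto x).comp (sqk_tendsto x)

/-- the value set over `C¹₀` -/
def Jset0 {n m : ℕ} (μ : VecMeas n m) : Set ℝ :=
  {r | ∃ f : Euc n → Euc m, C1z f ∧ C1Norm f ≤ 1 ∧ r = μ.pair f}

/-- the value set over `C¹` -/
def Jset {n m : ℕ} (μ : VecMeas n m) : Set ℝ :=
  {r | ∃ f : Euc n → Euc m, C1b f ∧ C1Norm f ≤ 1 ∧ r = μ.pair f}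

lemma Jset0_subset {n m : ℕ} (μ : VecMeas n m) : Jset0 μ ⊆ Jset μ := by
  rintro r ⟨f, hf, h1, h2⟩
  exact ⟨f, hf.c1b, h1, h2⟩

lemma Jset_bdd {n m : ℕ} (μ : VecMeas n m) (hzero : μ.totalZero) (hmom : μ.finiteFirstMoment) :
    BddAbove (Jset μ) := by
  refine ⟨∫ x, ‖x‖ ∂μ.var, ?_⟩
  rintro r ⟨f, hf, h1, rfl⟩
  exact pair_le μ hzero hmom (lip_one hf.1 (hf.norm_le h1))

lemma zero_mem_Jset0 {n m : ℕ} (μ : VecMeas n m) : (0 : ℝ) ∈ Jset0 μ := by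
  refine ⟨fun _ => 0, ⟨contDiff_const, by simpa using tendsto_const_nhds⟩, C1Norm_le (by simp), by simp [VecMeas.pair]⟩

lemma Jsup_eq {n m : ℕ} (μ : VecMeas n m) (hzero : μ.totalZero) (hmom : μ.finiteFirstMoment) :
    sSup (Jset μ) = sSup (Jset0 μ) := by
  apply le_antisymm
  · refine csSup_le ⟨0, Jset0_subset μ (zero_mem_Jset0 μ)⟩ ?_
    rintro r ⟨f, hf, h1, rfl⟩
    refine le_of_tendsto' (comp_sqk_pair μ hmom hf.1 (hf.norm_le h1)) fun k => ?_
    refine le_csSup ((Jset_bdd μ hzero hmom).mono (Jset0_subset μ)) ?_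
    exact ⟨_, comp_sqk_C1z hf.1 (hf.norm_le h1) k,
      C1Norm_le (comp_sqk_le_one hf.1 (hf.norm_le h1) k), rfl⟩
  · exact csSup_le_csSup (Jset_bdd μ hzero hmom) ⟨0, zero_mem_Jset0 μ⟩ (Jset0_subset μ)

lemma continuous_frob_left {n m : ℕ} (A : Matrix (Fin m) (Fin n) ℝ) :
    Continuous (fun L : Euc n →L[ℝ] Euc m => frob (matOf L) A) := by
  simp only [frob_eq_sum, matOf, Matrix.of_apply]
  fun_prop

lemma measurable_frob {n m : ℕ} {α : Type*} [MeasurableSpace α] {G : α → Euc n →L[ℝ] Euc m}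
    (hG : Measurable G) {A : α → Matrix (Fin m) (Fin n) ℝ} (hA : ∀ i j, Measurable fun x => A x i j) :
    Measurable fun x => frob (matOf (G x)) (A x) := by
  simp only [frob_eq_sum, matOf, Matrix.of_apply]
  refine Finset.measurable_sum _ fun i _ => Finset.measurable_sum _ fun j _ => ?_
  refine Measurable.mul ?_ (hA i j)
  have h1 : Measurable fun x => G x (EuclideanSpace.single j 1) := hG.apply_continuousLinearMap _
  have h2 : Continuous fun v : Euc m => v i := by fun_prop
  exact h2.measurable.comp h1

lemma MatMeas.pair_tendsto {n m : ℕ} (M : MatMeas n m) {G : ℕ → Euc n → Euc n →L[ℝ] Euc m}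
    {H : Euc n → Euc n →L[ℝ] Euc m} (hG : ∀ k, Measurable (G k)) (h1 : ∀ k x, ‖G k x‖ ≤ 1)
    (h : ∀ᵐ x ∂M.var, Tendsto (fun k => G k x) atTop (𝓝 (H x))) :
    Tendsto (fun k => M.pair (fun x => matOf (G k x))) atTop (𝓝 (M.pair (fun x => matOf (H x)))) := by
  have := M.finite
  refine tendsto_integral_of_dominated_convergence (fun _ => 1)
    (fun k => (measurable_frob (hG k) M.measurable_density).aestronglyMeasurable)
    (integrable_const _) ?_ ?_
  · intro k
    filter_upwards [M.norm_density] with x hx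
    have h2 := frob_le_trN (G k x) (M.density x)
    rw [trN, hx, mul_one] at h2
    exact h2.trans (h1 k x)
  · filter_upwards [h] with x hx
    exact ((continuous_frob_left _).tendsto _).comp hx

lemma negDiv_C1b {n m : ℕ} {μ : VecMeas n m} (hmom : μ.finiteFirstMoment)
    {M : MatMeas n m} (hM : IsNegDiv M μ) {u : Euc n → Euc m}
    (hu : ContDiff ℝ 1 u) (h : ∀ x, ‖fderiv ℝ u x‖ ≤ 1) : μ.pair u = M.pair (fderivMat u) := by
  refine tendsto_nhds_unique (comp_sqk_pair μ hmom hu h) ?_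
  simp_rw [hM _ (comp_sqk_C1z hu h _)]
  refine M.pair_tendsto (G := fun k x => fderiv ℝ (u ∘ sqk k) x) (H := fun x => fderiv ℝ u x)
    (fun k => measurable_fderiv ℝ _) (comp_sqk_le_one hu h) (Eventually.of_forall fun x => ?_)
  simp_rw [comp_sqk_fderiv hu]
  have h1 : Tendsto (fun k => fderiv ℝ u (sqk k x)) atTop (𝓝 (fderiv ℝ u x)) :=
    ((hu.continuous_fderiv one_ne_zero).tendsto x).comp (sqk_tendsto x)
  have hc : Continuous (fun p : (Euc n →L[ℝ] Euc m) × (Euc n →L[ℝ] Euc n) => p.1 ∘L p.2) := by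
    fun_prop
  have h2 := (hc.tendsto (fderiv ℝ u x, ContinuousLinearMap.id ℝ (Euc n))).comp
    (h1.prodMk_nhds (sqk_fderiv_tendsto x))
  simpa [Function.comp_def] using h2

lemma MatMeas.pair_le {n m : ℕ} (M : MatMeas n m) {G : Euc n → Euc n →L[ℝ] Euc m}
    (h1 : ∀ x, ‖G x‖ ≤ 1) : M.pair (fun x => matOf (G x)) ≤ M.tvNorm := by
  have := M.finite
  have h : ‖M.pair (fun x => matOf (G x))‖ ≤ 1 * (M.var Set.univ).toReal := by
    refine norm_integral_le_of_norm_le_const ?_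
    filter_upwards [M.norm_density] with x hx
    have h2 := frob_le_trN (G x) (M.density x)
    rw [trN, hx, mul_one] at h2
    exact h2.trans (h1 x)
  rw [one_mul] at h
  exact (le_abs_self _).trans h

lemma weak_duality {n m : ℕ} {μ : VecMeas n m} (hmom : μ.finiteFirstMoment)
    {M : MatMeas n m} (hM : IsNegDiv M μ) : sSup (Jset μ) ≤ M.tvNorm := by
  refine csSup_le ⟨0, Jset0_subset μ (zero_mem_Jset0 μ)⟩ ?_
  rintro r ⟨f, hf, h1, rfl⟩
  rw [negDiv_C1b hmom hM hf.1 (hf.norm_le h1)]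
  exact M.pair_le (G := fderiv ℝ f) (hf.norm_le h1)


lemma lip_subseq {n m : ℕ} (v : ℕ → Euc n → Euc m) (hv : ∀ k, LipschitzWith 1 (v k))
    (h0 : ∀ k, v k 0 = 0) : ∃ (u : Euc n → Euc m) (φ : ℕ → ℕ), StrictMono φ ∧
      ∀ x, Tendsto (fun k => v (φ k) x) atTop (𝓝 (u x)) := by
  let d := TopologicalSpace.denseSeq (Euc n)
  have hK : IsCompact (Set.pi Set.univ fun i : ℕ => Metric.closedBall (0 : Euc m) ‖d i‖) :=
    isCompact_univ_pi fun i => isCompact_closedBall _ _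
  obtain ⟨a, -, φ, hφ, ha⟩ := hK.tendsto_subseq (x := fun k i => v k (d i)) (by
    intro k i _
    rw [mem_closedBall_zero_iff]
    simpa [h0] using lip_bound (hv k) (d i))
  rw [tendsto_pi_nhds] at ha
  have key : ∀ x, ∃ y, Tendsto (fun k => v (φ k) x) atTop (𝓝 y) := by
    intro x
    refine cauchySeq_tendsto_of_complete (Metric.cauchySeq_iff.2 fun ε hε => ?_)
    obtain ⟨i, hi⟩ := (TopologicalSpace.denseRange_denseSeq (Euc n)).exists_dist_lt x
      (show 0 < ε / 3 by positivity)
    obtain ⟨N, hN⟩ := Metric.cauchySeq_iff.1 (ha i).cauchySeq (ε / 3) (by positivity)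
    refine ⟨N, fun k hk l hl => ?_⟩
    have h1 := hN k hk l hl
    have h2 := (hv (φ k)).dist_le_mul x (d i)
    have h3 := (hv (φ l)).dist_le_mul (d i) x
    rw [dist_comm (d i) x] at h3
    simp only [NNReal.coe_one, one_mul, Function.comp_apply] at h1 h2 h3
    have hi' : dist x (d i) < ε / 3 := hi
    have := dist_triangle4 (v (φ k) x) (v (φ k) (d i)) (v (φ l) (d i)) (v (φ l) x)
    linarith
  choose u hu using key
  exact ⟨u, φ, hφ, hu⟩

lemma exists_u0 {n m : ℕ} (μ : VecMeas n m) (hzero : μ.totalZero) (hmom : μ.finiteFirstMoment) :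
    ∃ u₀ : Euc n → Euc m, LipschitzWith 1 u₀ ∧ sSup (Jset μ) = μ.pair u₀ := by
  obtain ⟨r, -, hr, hr2⟩ := exists_seq_tendsto_sSup ⟨0, Jset0_subset μ (zero_mem_Jset0 μ)⟩
    (Jset_bdd μ hzero hmom)
  choose f hf h1 h2 using hr2
  have hl : ∀ k, LipschitzWith 1 (f k) := fun k => lip_one (hf k).1 ((hf k).norm_le (h1 k))
  have hl' : ∀ k, LipschitzWith 1 (fun x => f k x - f k 0) := fun k => by
    simpa using (hl k).sub (LipschitzWith.const' (K := 0) (f k 0))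
  obtain ⟨u, φ, hφ, hu⟩ := lip_subseq (fun k x => f k x - f k 0) hl' (by simp)
  refine ⟨u, LipschitzWith.of_dist_le_mul fun x y => ?_, ?_⟩
  · exact le_of_tendsto' ((hu x).dist (hu y)) fun k => (hl' (φ k)).dist_le_mul x y
  · have h3 := pair_tendsto μ hmom (fun k => hl' (φ k)) hu
    refine tendsto_nhds_unique (hr.comp hφ.tendsto_atTop) (h3.congr fun k => ?_)
    rw [pair_sub_const μ hzero hmom (hl _), Function.comp_apply, h2]

/-- the fixed mollifier -/
def bmp (n : ℕ) : ContDiffBump (0 : Euc n) := ⟨1, 2, one_pos, one_lt_two⟩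

/-- the normed mollifier -/
def wt (n : ℕ) : Euc n → ℝ := (bmp n).normed volume

lemma wt_nonneg {n : ℕ} (t : Euc n) : 0 ≤ wt n t := (bmp n).nonneg_normed t
lemma wt_integral (n : ℕ) : ∫ t, wt n t = 1 := (bmp n).integral_normed
lemma wt_contDiff (n : ℕ) : ContDiff ℝ 1 (wt n) := (bmp n).contDiff_normed
lemma wt_compact (n : ℕ) : HasCompactSupport (wt n) := (bmp n).hasCompactSupport_normed

lemma wt_integrable {n : ℕ} {F : Type*} [NormedAddCommGroup F] [NormedSpace ℝ F] {u : Euc n → F}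
    (hu : Continuous u) : Integrable (fun t => wt n t • u t) volume :=
  ((wt_contDiff n).continuous.smul hu).integrable_of_hasCompactSupport
    ((wt_compact n).smul_right)

/-- mollification at scale `c` -/
def mol {n m : ℕ} (c : ℝ) (u : Euc n → Euc m) (y : Euc n) : Euc m := ∫ t, wt n t • u (y - c • t)

lemma wt_integral_const {n m : ℕ} (v : Euc m) : ∫ t, wt n t • v = v := by
  rw [integral_smul_const, wt_integral, one_smul]

lemma mol_lip {n m : ℕ} (c : ℝ) {u : Euc n → Euc m} (hu : LipschitzWith 1 u) :
    LipschitzWith 1 (mol c u) := by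
  have hc := hu.continuous
  refine LipschitzWith.of_dist_le_mul fun x y => ?_
  rw [dist_eq_norm, mol, mol, ← integral_sub (wt_integrable (by fun_prop)) (wt_integrable (by fun_prop))]
  have h1 : ∫ t, wt n t • dist x y = dist x y := by
    rw [integral_smul_const, wt_integral, one_smul]
  rw [NNReal.coe_one, one_mul, ← h1]
  refine norm_integral_le_of_norm_le (wt_integrable continuous_const) (Eventually.of_forall fun t => ?_)
  rw [← smul_sub, norm_smul, Real.norm_of_nonneg (wt_nonneg t), smul_eq_mul]
  refine mul_le_mul_of_nonneg_left ?_ (wt_nonneg t)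
  have := hu.dist_le_mul (x - c • t) (y - c • t)
  simpa [dist_eq_norm] using this

lemma mol_close {n m : ℕ} {c : ℝ} (hc : 0 ≤ c) {u : Euc n → Euc m} (hu : LipschitzWith 1 u)
    (y : Euc n) : ‖mol c u y - u y‖ ≤ c * ∫ t, wt n t • ‖t‖ := by
  have hcu := hu.continuous
  have e : mol c u y - u y = (∫ t, wt n t • u (y - c • t)) - ∫ t, wt n t • u y := by
    rw [wt_integral_const, mol]
  rw [e, ← integral_sub (wt_integrable (by fun_prop)) (wt_integrable (by fun_prop)),
    ← integral_const_mul]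
  refine norm_integral_le_of_norm_le ((wt_integrable continuous_norm).const_mul _)
    (Eventually.of_forall fun t => ?_)
  rw [← smul_sub, norm_smul, Real.norm_of_nonneg (wt_nonneg t), smul_eq_mul]
  have := hu.dist_le_mul (y - c • t) y
  rw [dist_eq_norm, dist_eq_norm, sub_sub_cancel_left, norm_neg, norm_smul, Real.norm_of_nonneg hc,
    NNReal.coe_one, one_mul] at this
  nlinarith [mul_le_mul_of_nonneg_left this (wt_nonneg t)]

open scoped Convolution in
lemma mol_eq {n m : ℕ} {a : ℝ} (ha : 0 < a) {u : Euc n → Euc m} (hu : Continuous u) (x y : Euc n) :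
    mol a⁻¹ u y = u x + a⁻¹ • ((wt n) ⋆[ContinuousLinearMap.lsmul ℝ ℝ, volume]
      (fun t => a • (u (x + a⁻¹ • t) - u x))) (a • (y - x)) := by
  rw [convolution_def, ← integral_smul]
  have h : ∀ t, a⁻¹ • ((ContinuousLinearMap.lsmul ℝ ℝ) (wt n t))
      (a • (u (x + a⁻¹ • (a • (y - x) - t)) - u x)) = wt n t • u (y - a⁻¹ • t) - wt n t • u x := by
    intro t
    have e : x + a⁻¹ • (a • (y - x) - t) = y - a⁻¹ • t := by
      rw [smul_sub, smul_smul, inv_mul_cancel₀ ha.ne', one_smul]; abel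
    rw [e, ContinuousLinearMap.lsmul_apply, smul_comm (wt n t), smul_smul, inv_mul_cancel₀ ha.ne',
      one_smul, smul_sub]
  simp_rw [h]
  rw [integral_sub (wt_integrable (by fun_prop)) (wt_integrable (by fun_prop)), wt_integral_const, mol]
  abel

open scoped Convolution in
/-- the derivative of the convolution at 0 -/
def dcv {n m : ℕ} (U : Euc n → Euc m) : Euc n →L[ℝ] Euc m :=
  (fderiv ℝ (wt n) ⋆[(ContinuousLinearMap.lsmul ℝ ℝ).precompL (Euc n), volume] U) 0

lemma mol_contDiff {n m : ℕ} {a : ℝ} (ha : 0 < a) {u : Euc n → Euc m} (hu : Continuous u) :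
    ContDiff ℝ 1 (mol a⁻¹ u) := by
  have h : mol a⁻¹ u = fun y => _ := funext fun y => mol_eq ha hu 0 y
  rw [h]
  have h1 := (wt_compact n).contDiff_convolution_left (μ := volume) (n := 1)
    (ContinuousLinearMap.lsmul ℝ ℝ) (wt_contDiff n)
    (g := fun t => a • (u (0 + a⁻¹ • t) - u 0)) (by
      refine Continuous.locallyIntegrable ?_
      fun_prop)
  exact contDiff_const.add ((h1.comp ((contDiff_id.sub contDiff_const).const_smul a)).const_smul _)

lemma mol_fderiv {n m : ℕ} {a : ℝ} (ha : 0 < a) {u : Euc n → Euc m} (hu : Continuous u) (x : Euc n) :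
    fderiv ℝ (mol a⁻¹ u) x = dcv (fun t => a • (u (x + a⁻¹ • t) - u x)) := by
  have h : mol a⁻¹ u = fun y => _ := funext fun y => mol_eq ha hu x y
  rw [h]
  have h1 := (wt_compact n).hasFDerivAt_convolution_left (μ := volume)
    (ContinuousLinearMap.lsmul ℝ ℝ) (wt_contDiff n)
    (g := fun t => a • (u (x + a⁻¹ • t) - u x)) (by
      refine Continuous.locallyIntegrable ?_
      fun_prop) (a • (x - x))
  have h2 : HasFDerivAt (fun y : Euc n => a • (y - x)) (a • ContinuousLinearMap.id ℝ (Euc n)) x :=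
    ((hasFDerivAt_id x).sub_const x).const_smul a
  have h3 := ((h1.comp x h2).const_smul a⁻¹).const_add (u x)
  rw [sub_self, smul_zero] at h3
  refine (HasFDerivAt.fderiv h3).trans ?_
  ext v i
  simp [dcv, ha.ne']

lemma precompL_bound {n m : ℕ} (f : Euc n →L[ℝ] ℝ) (g : Euc m) :
    ‖(ContinuousLinearMap.lsmul ℝ ℝ : ℝ →L[ℝ] Euc m →L[ℝ] Euc m).precompL (Euc n) f g‖
      ≤ ‖f‖ * ‖g‖ := by
  refine ContinuousLinearMap.opNorm_le_bound _ (by positivity) fun v => ?_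
  rw [ContinuousLinearMap.precompL_apply, ContinuousLinearMap.lsmul_apply, norm_smul]
  nlinarith [mul_le_mul_of_nonneg_right (f.le_opNorm v) (norm_nonneg g)]

lemma dcv_linear {n m : ℕ} (T : Euc n →L[ℝ] Euc m) : dcv (fun t => T t) = T := by
  have h1 := mol_fderiv (a := 1) one_pos T.continuous 0
  simp only [inv_one, one_smul, zero_add, map_zero, sub_zero] at h1
  rw [← h1]
  have h2 : mol 1 T = fun y => T y - ∫ t, wt n t • T t := by
    funext y
    simp only [mol, one_smul, map_sub, smul_sub]
    rw [integral_sub (wt_integrable (by fun_prop)) (wt_integrable (by fun_prop)), wt_integral_const]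
  rw [h2]
  exact (T.hasFDerivAt.sub_const _).fderiv

lemma dcv_tendsto {n m : ℕ} {V : ℕ → Euc n → Euc m} {W : Euc n → Euc m}
    (hV : ∀ k, Continuous (V k)) (hb : ∀ k t, ‖V k t‖ ≤ ‖t‖)
    (h : ∀ t, Tendsto (fun k => V k t) atTop (𝓝 (W t))) :
    Tendsto (fun k => dcv (V k)) atTop (𝓝 (dcv W)) := by
  have hc : Continuous (fderiv ℝ (wt n)) := (wt_contDiff n).continuous_fderiv one_ne_zero
  simp only [dcv, convolution_def]
  refine tendsto_integral_of_dominated_convergence (fun t => ‖fderiv ℝ (wt n) t‖ * ‖t‖)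
    (fun k => ?_) ?_ ?_ ?_
  · have := hV k
    refine Continuous.aestronglyMeasurable ?_
    fun_prop
  · refine (hc.norm.mul continuous_norm).integrable_of_hasCompactSupport ?_
    exact ((wt_compact n).fderiv ℝ).norm.mul_right
  · intro k
    refine Eventually.of_forall fun t => ?_
    refine (precompL_bound _ _).trans ?_
    gcongr
    simpa using hb k (0 - t)
  · refine Eventually.of_forall fun t => ?_
    exact ((ContinuousLinearMap.precompL (Euc n) (ContinuousLinearMap.lsmul ℝ ℝ)
      (fderiv ℝ (wt n) t)).continuous.tendsto _).comp (h (0 - t))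

lemma mol_fderiv_tendsto {n m : ℕ} {u : Euc n → Euc m} (hu : LipschitzWith 1 u) {x : Euc n}
    (hx : DifferentiableAt ℝ u x) :
    Tendsto (fun k : ℕ => fderiv ℝ (mol ((k : ℝ) + 1)⁻¹ u) x) atTop (𝓝 (fderiv ℝ u x)) := by
  have hp : ∀ k : ℕ, 0 < (k : ℝ) + 1 := fun k => by positivity
  have hc := hu.continuous
  simp_rw [mol_fderiv (hp _) hu.continuous x]
  rw [← dcv_linear (fderiv ℝ u x)]
  refine dcv_tendsto (fun k => by fun_prop) (fun k t => ?_) (fun t => ?_)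
  · have := hu.dist_le_mul (x + ((k : ℝ) + 1)⁻¹ • t) x
    rw [dist_eq_norm, dist_eq_norm, add_sub_cancel_left, norm_smul, NNReal.coe_one, one_mul,
      Real.norm_of_nonneg (inv_nonneg.2 (hp k).le)] at this
    rw [norm_smul, Real.norm_of_nonneg (hp k).le]
    refine (mul_le_mul_of_nonneg_left this (hp k).le).trans ?_
    rw [← mul_assoc, mul_inv_cancel₀ (hp k).ne', one_mul]
  · refine hx.hasFDerivAt.lim t ?_
    refine tendsto_norm_atTop_atTop.comp ?_
    exact tendsto_atTop_add_const_right _ _ tendsto_natCast_atTop_atTop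

lemma negDiv_lip {n m : ℕ} {μ : VecMeas n m} (hmom : μ.finiteFirstMoment)
    {M : MatMeas n m} (hM : IsNegDiv M μ) {u : Euc n → Euc m}
    (hu : LipschitzWith 1 u) (hd : ∀ᵐ x ∂M.var, DifferentiableAt ℝ u x) :
    μ.pair u = M.pair (fderivMat u) := by
  have hp : ∀ k : ℕ, 0 < (k : ℝ) + 1 := fun k => by positivity
  have hle : ∀ (k : ℕ) x, ‖fderiv ℝ (mol ((k : ℝ) + 1)⁻¹ u) x‖ ≤ 1 := fun k x => by
    simpa using norm_fderiv_le_of_lipschitz ℝ (mol_lip _ hu) (x₀ := x)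
  have h1 : Tendsto (fun k : ℕ => μ.pair (mol ((k : ℝ) + 1)⁻¹ u)) atTop (𝓝 (μ.pair u)) := by
    refine pair_tendsto μ hmom (fun k => mol_lip _ hu) fun x => ?_
    rw [tendsto_iff_norm_sub_tendsto_zero]
    refine squeeze_zero (fun _ => norm_nonneg _)
      (fun k => mol_close (inv_nonneg.2 (hp k).le) hu x) ?_
    have : Tendsto (fun k : ℕ => ((k : ℝ) + 1)⁻¹) atTop (𝓝 0) := by
      simpa using tendsto_one_div_add_atTop_nhds_zero_nat (𝕜 := ℝ)
    simpa using this.mul_const (∫ t, wt n t • ‖t‖)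
  refine tendsto_nhds_unique h1 ?_
  simp_rw [fun k : ℕ => negDiv_C1b hmom hM (mol_contDiff (hp k) hu.continuous) (hle k)]
  refine M.pair_tendsto (G := fun (k : ℕ) x => fderiv ℝ (mol ((k : ℝ) + 1)⁻¹ u) x)
    (H := fun x => fderiv ℝ u x) (fun k => measurable_fderiv ℝ _) hle ?_
  filter_upwards [hd] with x hx using mol_fderiv_tendsto hu hx

lemma part_iv {n m : ℕ} {μ : VecMeas n m} (hmom : μ.finiteFirstMoment)
    {M : MatMeas n m} (hM : IsNegDiv M μ) {u : Euc n → Euc m}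
    (hu : LipschitzWith 1 u) (hd : ∀ᵐ x ∂M.var, DifferentiableAt ℝ u x)
    (h : μ.pair u = M.tvNorm) : ∀ᵐ x ∂M.var, frob (fderivMat u x) (M.density x) = 1 := by
  have := M.finite
  rw [negDiv_lip hmom hM hu hd, MatMeas.pair] at h
  have hle : ∀ x, ‖fderiv ℝ u x‖ ≤ 1 := fun x => by
    simpa using norm_fderiv_le_of_lipschitz ℝ hu (x₀ := x)
  have hb : ∀ᵐ x ∂M.var, |frob (fderivMat u x) (M.density x)| ≤ 1 := by
    filter_upwards [M.norm_density] with x hx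
    have h2 := frob_le_trN (fderiv ℝ u x) (M.density x)
    rw [trN, hx, mul_one] at h2
    exact h2.trans (hle x)
  have hi : Integrable (fun x => frob (fderivMat u x) (M.density x)) M.var :=
    Integrable.mono' (integrable_const 1)
      (measurable_frob (measurable_fderiv ℝ u) M.measurable_density).aestronglyMeasurable hb
  have h0 : ∫ x, (1 - frob (fderivMat u x) (M.density x)) ∂M.var = 0 := by
    rw [integral_sub (integrable_const _) hi, h, MatMeas.tvNorm]
    simp [Measure.real]
  have hnn : 0 ≤ᵐ[M.var] fun x => 1 - frob (fderivMat u x) (M.density x) := by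
    filter_upwards [hb] with x hx
    simp only [Pi.zero_apply]
    linarith [(abs_le.1 hx).2]
  have h0' := (integral_eq_zero_iff_of_nonneg_ae hnn ((integrable_const _).sub hi)).1 h0
  filter_upwards [h0'] with x hx
  simp only [Pi.zero_apply] at hx
  linarith


open scoped BoundedContinuousFunction CompactlySupported

/-- Hahn–Banach for a functional dominated through a linear map. -/
lemma hahn_banach_through {W E : Type*} [AddCommGroup W] [Module ℝ W] [AddCommGroup E] [Module ℝ E]
    (T : W →ₗ[ℝ] E) (l : W →ₗ[ℝ] ℝ) (N : E → ℝ)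
    (N_hom : ∀ c : ℝ, 0 < c → ∀ x, N (c • x) = c * N x) (N_add : ∀ x y, N (x + y) ≤ N x + N y)
    (h : ∀ w, l w ≤ N (T w)) :
    ∃ Λ : E →ₗ[ℝ] ℝ, (∀ w, Λ (T w) = l w) ∧ ∀ x, Λ x ≤ N x := by
  have N_0 : N 0 = 0 := by
    have := N_hom 2 (by norm_num) 0
    rw [smul_zero] at this; linarith
  have key : ∀ w, T w = 0 → l w = 0 := by
    intro w hw
    have h1 := h w
    have h2 := h (-w)
    rw [map_neg, map_neg, hw, neg_zero, N_0] at h2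
    rw [hw, N_0] at h1
    linarith
  obtain ⟨r, hr⟩ := LinearMap.exists_rightInverse_of_surjective T.rangeRestrict T.range_rangeRestrict
  have hr' : ∀ y : LinearMap.range T, T (r y) = y := by
    intro y
    have := congrArg (fun g => ((g y : LinearMap.range T) : E)) hr
    simpa using this
  let f : E →ₗ.[ℝ] ℝ := ⟨LinearMap.range T, l.comp r⟩
  obtain ⟨g, hg1, hg2⟩ := exists_extension_of_le_sublinear f N N_hom N_add (by
    intro x
    have := h (r x)
    rw [hr' x] at this
    exact this)
  refine ⟨g, fun w => ?_, hg2⟩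
  have h1 := hg1 ⟨T w, LinearMap.mem_range_self T w⟩
  change g (T w) = l (r ⟨T w, LinearMap.mem_range_self T w⟩) at h1
  rw [h1]
  have h2 := key (r ⟨T w, LinearMap.mem_range_self T w⟩ - w) (by rw [map_sub, hr']; simp)
  rw [map_sub] at h2
  linarith

/-- cutoff -/
def cutoff {n : ℕ} (k : ℕ) (x : Euc n) : ℝ := max 0 (min 1 ((k : ℝ) + 1 - ‖x‖))

lemma cutoff_cont {n : ℕ} (k : ℕ) : Continuous (cutoff k : Euc n → ℝ) := by
  unfold cutoff; fun_prop
lemma cutoff_nonneg {n : ℕ} (k : ℕ) (x : Euc n) : 0 ≤ cutoff k x := le_max_left _ _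
lemma cutoff_le {n : ℕ} (k : ℕ) (x : Euc n) : cutoff k x ≤ 1 := max_le zero_le_one (min_le_left _ _)
lemma cutoff_one {n : ℕ} {k : ℕ} {x : Euc n} (h : ‖x‖ ≤ k) : cutoff k x = 1 := by
  unfold cutoff
  rw [min_eq_left (by linarith)]; norm_num
lemma cutoff_zero {n : ℕ} {k : ℕ} {x : Euc n} (h : (k : ℝ) + 1 ≤ ‖x‖) : cutoff k x = 0 := by
  unfold cutoff
  exact max_eq_left ((min_le_right _ _).trans (by linarith))

lemma cutoff_support {n : ℕ} {Ω : Type*} [TopologicalSpace Ω] [CompactSpace Ω] [T2Space Ω] (k : ℕ)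
    (F : Euc n × Ω → ℝ) : HasCompactSupport (fun y => cutoff k y.1 * F y) := by
  refine HasCompactSupport.of_support_subset_isCompact
    ((isCompact_closedBall (0 : Euc n) ((k : ℝ) + 1)).prod (isCompact_univ (X := Ω))) ?_
  intro y hy
  refine ⟨?_, Set.mem_univ _⟩
  by_contra hc
  apply hy
  simp only [Metric.mem_closedBall, dist_zero_right, not_le] at hc
  simp [cutoff_zero hc.le]

/-- multiplication of a bounded continuous function by a cutoff -/
def cutC {n : ℕ} {Ω : Type*} [TopologicalSpace Ω] [CompactSpace Ω] [T2Space Ω] (k : ℕ)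
    (F : (Euc n × Ω) →ᵇ ℝ) : C_c(Euc n × Ω, ℝ) where
  toFun y := cutoff k y.1 * F y
  continuous_toFun := ((cutoff_cont k).comp continuous_fst).mul F.continuous
  hasCompactSupport' := cutoff_support k F

/-- inclusion of compactly supported functions into bounded ones -/
def ccIncl {Y : Type*} [TopologicalSpace Y] : C_c(Y, ℝ) →ₗ[ℝ] (Y →ᵇ ℝ) where
  toFun f := BoundedContinuousFunction.ofNormedAddCommGroup f f.continuous
    (Classical.choose (f.hasCompactSupport.exists_bound_of_continuous f.continuous))
    (Classical.choose_spec (f.hasCompactSupport.exists_bound_of_continuous f.continuous))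
  map_add' f g := by ext x; simp
  map_smul' c f := by ext x; simp

lemma ccIncl_apply {Y : Type*} [TopologicalSpace Y] (f : C_c(Y, ℝ)) (y : Y) : ccIncl f y = f y := rfl

lemma riesz_repr {n : ℕ} {Ω : Type*} [TopologicalSpace Ω] [CompactSpace Ω] [T2Space Ω]
    [SecondCountableTopology Ω] [MeasurableSpace Ω] [BorelSpace Ω]
    (Λ : ((Euc n × Ω) →ᵇ ℝ) →ₗ[ℝ] ℝ) {J : ℝ} (hJ : 0 ≤ J)
    (hΛ : ∀ (F : (Euc n × Ω) →ᵇ ℝ) (c : ℝ), 0 ≤ c → (∀ y, F y ≤ c) → Λ F ≤ J * c) :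
    ∃ π : Measure (Euc n × Ω), π Set.univ ≤ ENNReal.ofReal J ∧
      ∀ F : (Euc n × Ω) →ᵇ ℝ, (∀ ε > 0, ∃ k : ℕ, ∀ y, (k : ℝ) ≤ ‖y.1‖ → |F y| ≤ ε) →
        Λ F = ∫ y, F y ∂π := by
  let Λ' : C_c(Euc n × Ω, ℝ) →ₚ[ℝ] ℝ := PositiveLinearMap.mk₀ (Λ.comp ccIncl) (by
    intro f hf
    have := hΛ (-(ccIncl f)) 0 le_rfl (fun y => by
      have : 0 ≤ f y := hf y
      simpa [ccIncl_apply] using this)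
    rw [map_neg] at this
    simp only [LinearMap.comp_apply]
    linarith)
  have hΛ' : ∀ f, Λ' f = Λ (ccIncl f) := fun f => rfl
  have hone : ∀ k : ℕ, RealRMK.rieszMeasure Λ' (Metric.closedBall (0 : Euc n) k ×ˢ Set.univ) ≤
      ENNReal.ofReal J := by
    intro k
    refine (RealRMK.rieszMeasure_le_of_eq_one Λ' (f := cutC k (BoundedContinuousFunction.const _ 1))
      ?_ ((isCompact_closedBall _ _).prod isCompact_univ) ?_).trans ?_
    · intro y
      simpa [cutC] using cutoff_nonneg k y.1
    · intro y hy
      have : ‖y.1‖ ≤ k := by simpa using hy.1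
      simpa [cutC] using cutoff_one this
    · apply ENNReal.ofReal_le_ofReal
      rw [hΛ']
      have := hΛ (ccIncl (cutC k (BoundedContinuousFunction.const _ 1))) 1 zero_le_one (fun y => by
        rw [ccIncl_apply]
        simpa [cutC] using cutoff_le k y.1)
      simpa using this
  have huniv : (⋃ k : ℕ, Metric.closedBall (0 : Euc n) k ×ˢ (Set.univ : Set Ω)) = Set.univ := by
    ext y
    simp only [Set.mem_iUnion, Set.mem_univ, iff_true]
    obtain ⟨k, hk⟩ := exists_nat_ge ‖y.1‖
    exact ⟨k, by simpa using hk, Set.mem_univ _⟩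
  have hmono : Monotone (fun k : ℕ => Metric.closedBall (0 : Euc n) k ×ˢ (Set.univ : Set Ω)) := by
    intro a b hab
    exact Set.prod_mono (Metric.closedBall_subset_closedBall (by exact_mod_cast hab)) le_rfl
  have hfin : RealRMK.rieszMeasure Λ' Set.univ ≤ ENNReal.ofReal J := by
    rw [← huniv, hmono.measure_iUnion]
    exact iSup_le hone
  refine ⟨RealRMK.rieszMeasure Λ', hfin, fun F hF => ?_⟩
  have : IsFiniteMeasure (RealRMK.rieszMeasure Λ') := ⟨hfin.trans_lt ENNReal.ofReal_lt_top⟩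
  have hlim1 : Tendsto (fun k => ∫ y, cutC k F y ∂(RealRMK.rieszMeasure Λ')) atTop
      (𝓝 (∫ y, F y ∂(RealRMK.rieszMeasure Λ'))) := by
    refine tendsto_integral_of_dominated_convergence (fun _ => ‖F‖) ?_ (integrable_const _) ?_ ?_
    · intro k; exact (cutC k F).continuous.aestronglyMeasurable
    · intro k; refine ae_of_all _ fun y => ?_
      change ‖cutoff k y.1 * F y‖ ≤ _
      rw [norm_mul, Real.norm_of_nonneg (cutoff_nonneg _ _)]
      have := F.norm_coe_le_norm y
      nlinarith [cutoff_nonneg k y.1, cutoff_le k y.1, norm_nonneg (F y)]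
    · refine ae_of_all _ fun y => ?_
      apply tendsto_const_nhds.congr'
      obtain ⟨k, hk⟩ := exists_nat_ge ‖y.1‖
      filter_upwards [eventually_ge_atTop k] with j hj
      change F y = cutoff j y.1 * F y
      rw [cutoff_one (hk.trans (by exact_mod_cast hj)), one_mul]
  have hlim2 : Tendsto (fun k => Λ (ccIncl (cutC k F))) atTop (𝓝 (Λ F)) := by
    rw [Metric.tendsto_atTop]
    intro ε hε
    have hJ1 : 0 < J + 1 := by linarith
    obtain ⟨k, hk⟩ := hF (ε / (J + 1)) (by positivity)
    refine ⟨k, fun j hj => ?_⟩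
    have hb : ∀ y, |ccIncl (cutC j F) y - F y| ≤ ε / (J + 1) := by
      intro y
      change |cutoff j y.1 * F y - F y| ≤ _
      rcases le_total ‖y.1‖ j with h | h
      · rw [cutoff_one h]; simp; positivity
      · have h1 := hk y ((by exact_mod_cast hj : (k : ℝ) ≤ j).trans h)
        have h2 : cutoff j y.1 * F y - F y = -((1 - cutoff j y.1) * F y) := by ring
        rw [h2, abs_neg, abs_mul, abs_of_nonneg (by linarith [cutoff_le j y.1])]
        nlinarith [cutoff_nonneg j y.1, cutoff_le j y.1, abs_nonneg (F y)]
    have h1 := hΛ (ccIncl (cutC j F) - F) _ (by positivity) (fun y => (abs_le.1 (hb y)).2)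
    have h2 := hΛ (F - ccIncl (cutC j F)) (ε / (J + 1)) (by positivity) (fun y => by
      have := (abs_le.1 (hb y)).1
      rw [BoundedContinuousFunction.sub_apply]; linarith)
    have h3 : J * (ε / (J + 1)) < ε := by
      rw [mul_div_assoc', div_lt_iff₀ hJ1]; nlinarith
    rw [map_sub] at h1 h2
    rw [Real.dist_eq, abs_lt]
    constructor <;> linarith
  refine tendsto_nhds_unique hlim2 (hlim1.congr fun k => ?_)
  rw [RealRMK.integral_rieszMeasure, hΛ']

open scoped BoundedContinuousFunction CompactlySupported

/-- the space `C¹₀` as a submodule -/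
def C1zSub (n m : ℕ) : Submodule ℝ (Euc n → Euc m) where
  carrier := {f | C1z f}
  zero_mem' := ⟨contDiff_const, by
    have : (fun x : Euc n => ‖fderiv ℝ (0 : Euc n → Euc m) x‖) = fun _ => 0 := by
      ext x; simp
    rw [this]; exact tendsto_const_nhds⟩
  add_mem' := by
    rintro f g ⟨hf, hf'⟩ ⟨hg, hg'⟩
    refine ⟨hf.add hg, squeeze_zero (fun _ => norm_nonneg _) (fun x => ?_) (by simpa using hf'.add hg')⟩
    rw [fderiv_add (hf.differentiable one_ne_zero x) (hg.differentiable one_ne_zero x)]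
    exact norm_add_le _ _
  smul_mem' := by
    rintro c f ⟨hf, hf'⟩
    refine ⟨hf.const_smul c, ?_⟩
    have : (fun x : Euc n => ‖fderiv ℝ (c • f) x‖) = fun x => ‖c‖ * ‖fderiv ℝ f x‖ := by
      ext x
      rw [fderiv_const_smul (hf.differentiable one_ne_zero x), norm_smul]
    rw [this]
    simpa using hf'.const_mul ‖c‖

lemma C1z.integrable {n m : ℕ} (μ : VecMeas n m) (hmom : μ.finiteFirstMoment) {f : Euc n → Euc m}
    (hf : C1z f) : Integrable (fun x => ⟪f x, μ.density x⟫) μ.var := by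
  obtain ⟨C, hC⟩ := hf.bdd
  have hC0 : 0 ≤ C := (norm_nonneg _).trans (hC 0)
  exact integrable_pair μ hmom (lip_of_fderiv hf.1 hC0 hC)

/-- the functional `f ↦ ∫⟨f, dμ⟩` on `C¹₀` -/
def pairLin {n m : ℕ} (μ : VecMeas n m) (hmom : μ.finiteFirstMoment) : C1zSub n m →ₗ[ℝ] ℝ where
  toFun f := μ.pair f
  map_add' f g := by
    unfold VecMeas.pair
    rw [← integral_add (C1z.integrable μ hmom f.2) (C1z.integrable μ hmom g.2)]
    simp [inner_add_left]
  map_smul' c f := by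
    unfold VecMeas.pair
    simp only [RingHom.id_apply, smul_eq_mul]
    rw [← integral_const_mul]
    simp [inner_smul_left]

/-- closed unit ball -/
abbrev UB (n : ℕ) := Metric.closedBall (0 : Euc n) 1

lemma UB_norm {n : ℕ} (v : UB n) : ‖(v : Euc n)‖ ≤ 1 := mem_closedBall_zero_iff.1 v.2

instance UB_compact (n : ℕ) : CompactSpace (UB n) :=
  isCompact_iff_compactSpace.1 (isCompact_closedBall _ _)

/-- the zero of the unit ball -/
instance UB_inh (n : ℕ) : Inhabited (UB n) := ⟨⟨0, by simp⟩⟩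

instance UB_sb (n : ℕ) : StandardBorelSpace (UB n) :=
  (Metric.isClosed_closedBall.measurableSet).standardBorel

lemma inner_UB_le {n m : ℕ} (L : Euc n →L[ℝ] Euc m) (v : UB m) (w : UB n) :
    |⟪(v : Euc m), L w⟫| ≤ ‖L‖ := by
  have h1 := abs_real_inner_le_norm (v : Euc m) (L w)
  have h2 := L.le_opNorm (w : Euc n)
  have h3 := UB_norm v
  have h4 := UB_norm w
  have h5 : ‖L w‖ ≤ ‖L‖ := h2.trans (by nlinarith [norm_nonneg L])
  nlinarith [norm_nonneg (L w)]

lemma opNorm_le_of_UB {n m : ℕ} (L : Euc n →L[ℝ] Euc m) {c : ℝ} (hc : 0 ≤ c)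
    (h : ∀ (v : UB m) (w : UB n), ⟪(v : Euc m), L w⟫ ≤ c) : ‖L‖ ≤ c := by
  refine L.opNorm_le_of_unit_norm hc ?_
  intro w hw
  by_cases h0 : L w = 0
  · simpa [h0] using hc
  · have hn : ‖L w‖ ≠ 0 := norm_ne_zero_iff.2 h0
    have := h ⟨‖L w‖⁻¹ • L w, by simp [norm_smul, inv_mul_cancel₀ hn]⟩ ⟨w, by simp [hw]⟩
    simp only [inner_smul_left, real_inner_self_eq_norm_sq] at this
    have h2 : ‖L w‖⁻¹ * ‖L w‖ ^ 2 = ‖L w‖ := by field_simp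
    simpa [h2] using this

/-- the derivative as a bounded continuous function -/
def derivLin (n m : ℕ) : C1zSub n m →ₗ[ℝ] ((Euc n × (UB m × UB n)) →ᵇ ℝ) where
  toFun f := BoundedContinuousFunction.ofNormedAddCommGroup
    (fun y => ⟪(y.2.1 : Euc m), fderiv ℝ (f : Euc n → Euc m) y.1 y.2.2⟫)
    (by
      have : Continuous (fderiv ℝ (f : Euc n → Euc m)) := f.2.1.continuous_fderiv one_ne_zero
      fun_prop)
    (Classical.choose (C1z.bdd f.2))
    (fun y => (inner_UB_le _ _ _).trans (Classical.choose_spec (C1z.bdd f.2) y.1))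
  map_add' f g := by
    ext y
    simp only [BoundedContinuousFunction.coe_ofNormedAddCommGroup, BoundedContinuousFunction.add_apply,
      Submodule.coe_add]
    rw [fderiv_add (f.2.1.differentiable one_ne_zero _) (g.2.1.differentiable one_ne_zero _)]
    simp [inner_add_right]
  map_smul' c f := by
    ext y
    simp only [BoundedContinuousFunction.coe_ofNormedAddCommGroup, BoundedContinuousFunction.smul_apply,
      Submodule.coe_smul, RingHom.id_apply]
    rw [fderiv_const_smul (f.2.1.differentiable one_ne_zero _)]
    simp [inner_smul_right]

lemma derivLin_apply {n m : ℕ} (f : C1zSub n m) (y : Euc n × (UB m × UB n)) :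
    derivLin n m f y = ⟪(y.2.1 : Euc m), fderiv ℝ (f : Euc n → Euc m) y.1 y.2.2⟫ := rfl

/-- positive sup -/
def psup {Y : Type*} [TopologicalSpace Y] (F : Y →ᵇ ℝ) : ℝ := ⨆ y, max (F y) 0

lemma psup_bdd {Y : Type*} [TopologicalSpace Y] (F : Y →ᵇ ℝ) :
    BddAbove (Set.range fun y => max (F y) 0) := by
  refine ⟨‖F‖, ?_⟩
  rintro _ ⟨y, rfl⟩
  exact max_le ((le_abs_self _).trans (F.norm_coe_le_norm y)) (norm_nonneg _)

lemma le_psup {Y : Type*} [TopologicalSpace Y] (F : Y →ᵇ ℝ) (y : Y) : F y ≤ psup F :=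
  (le_max_left _ _).trans (le_ciSup (psup_bdd F) y)

lemma psup_nonneg {Y : Type*} [TopologicalSpace Y] (F : Y →ᵇ ℝ) : 0 ≤ psup F :=
  Real.iSup_nonneg fun _ => le_max_right _ _

lemma psup_le {Y : Type*} [TopologicalSpace Y] (F : Y →ᵇ ℝ) {c : ℝ} (hc : 0 ≤ c) (h : ∀ y, F y ≤ c) :
    psup F ≤ c := Real.iSup_le (fun y => max_le (h y) hc) hc

lemma psup_add {Y : Type*} [TopologicalSpace Y] (F G : Y →ᵇ ℝ) : psup (F + G) ≤ psup F + psup G :=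
  psup_le _ (add_nonneg (psup_nonneg _) (psup_nonneg _)) fun y => add_le_add (le_psup F y) (le_psup G y)

lemma psup_smul_le {Y : Type*} [TopologicalSpace Y] {c : ℝ} (hc : 0 < c) (F : Y →ᵇ ℝ) :
    psup (c • F) ≤ c * psup F :=
  psup_le _ (mul_nonneg hc.le (psup_nonneg _)) fun y => mul_le_mul_of_nonneg_left (le_psup F y) hc.le

lemma psup_smul {Y : Type*} [TopologicalSpace Y] {c : ℝ} (hc : 0 < c) (F : Y →ᵇ ℝ) :
    psup (c • F) = c * psup F := by
  apply le_antisymm (psup_smul_le hc F)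
  have := psup_smul_le (inv_pos.2 hc) (c • F)
  rw [smul_smul, inv_mul_cancel₀ hc.ne', one_smul] at this
  have h2 := mul_le_mul_of_nonneg_left this hc.le
  rwa [← mul_assoc, mul_inv_cancel₀ hc.ne', one_mul] at h2

lemma pair_le_of_bound {n m : ℕ} (μ : VecMeas n m) (hzero : μ.totalZero) (hmom : μ.finiteFirstMoment)
    {f : Euc n → Euc m} (hf : C1z f) {c : ℝ} (hc : 0 < c) (h : ∀ x, ‖fderiv ℝ f x‖ ≤ c) :
    μ.pair f ≤ sSup (Jset0 μ) * c := by
  have h1 : C1z (c⁻¹ • f) := (C1zSub n m).smul_mem c⁻¹ hf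
  have h2 : μ.pair (c⁻¹ • f) = c⁻¹ * μ.pair f := (pairLin μ hmom).map_smul c⁻¹ ⟨f, hf⟩
  have h3 : μ.pair (c⁻¹ • f) ≤ sSup (Jset0 μ) := by
    refine le_csSup ((Jset_bdd μ hzero hmom).mono (Jset0_subset μ)) ⟨_, h1, C1Norm_le fun x => ?_, rfl⟩
    rw [fderiv_const_smul (hf.1.differentiable one_ne_zero x), norm_smul,
      Real.norm_of_nonneg (inv_pos.2 hc).le, inv_mul_le_iff₀ hc, mul_one]
    exact h x
  rw [h2, inv_mul_le_iff₀ hc] at h3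
  linarith

lemma exists_pi {n m : ℕ} (μ : VecMeas n m) (hzero : μ.totalZero) (hmom : μ.finiteFirstMoment) :
    ∃ π : Measure (Euc n × (UB m × UB n)), π Set.univ ≤ ENNReal.ofReal (sSup (Jset0 μ)) ∧
      ∀ f : Euc n → Euc m, C1z f →
        μ.pair f = ∫ y, ⟪(y.2.1 : Euc m), fderiv ℝ f y.1 y.2.2⟫ ∂π := by
  set J := sSup (Jset0 μ) with hJdef
  have hJ : 0 ≤ J := le_csSup ((Jset_bdd μ hzero hmom).mono (Jset0_subset μ)) (zero_mem_Jset0 μ)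
  obtain ⟨Λ, h1, h2⟩ := hahn_banach_through (derivLin n m) (pairLin μ hmom) (fun F => J * psup F)
    (fun c hc F => by simp only [psup_smul hc]; ring)
    (fun F G => by
      have := mul_le_mul_of_nonneg_left (psup_add F G) hJ
      linarith)
    (fun f => by
      have key : ∀ ε : ℝ, 0 < ε → μ.pair f ≤ J * (psup (derivLin n m f) + ε) := by
        intro ε hε
        have hp := psup_nonneg (derivLin n m f)
        refine pair_le_of_bound μ hzero hmom f.2 (by linarith) fun x => ?_
        refine opNorm_le_of_UB _ (by linarith) fun v w => ?_
        have := le_psup (derivLin n m f) (x, v, w)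
        rw [derivLin_apply] at this
        simp only at this
        linarith
      change μ.pair f ≤ J * psup (derivLin n m f)
      have ht : Tendsto (fun ε : ℝ => J * (psup (derivLin n m f) + ε)) (𝓝[>] 0)
          (𝓝 (J * (psup (derivLin n m f) + 0))) := by
        apply Tendsto.mono_left _ nhdsWithin_le_nhds
        exact Continuous.tendsto (by fun_prop) 0
      rw [add_zero] at ht
      exact ge_of_tendsto ht (by filter_upwards [self_mem_nhdsWithin] with ε hε using key ε hε))
  obtain ⟨π, hp1, hp2⟩ := riesz_repr Λ hJ (fun F c hc hF =>
    (h2 F).trans (mul_le_mul_of_nonneg_left (psup_le F hc hF) hJ))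
  refine ⟨π, hp1, fun f hf => ?_⟩
  have h3 := hp2 (derivLin n m ⟨f, hf⟩) (by
    intro ε hε
    have h4 := hf.2.eventually (gt_mem_nhds hε)
    rw [← Metric.cobounded_eq_cocompact, ← comap_norm_atTop, eventually_comap] at h4
    obtain ⟨a, ha⟩ := eventually_atTop.1 h4
    obtain ⟨k, hk⟩ := exists_nat_ge a
    refine ⟨k, fun y hy => ?_⟩
    rw [derivLin_apply]
    exact (inner_UB_le _ _ _).trans (ha _ (hk.trans hy) y.1 rfl).le)
  rw [h1] at h3
  exact h3


lemma inner_eq_sum {n m : ℕ} (L : Euc n →L[ℝ] Euc m) (v : Euc m) (w : Euc n) :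
    ⟪v, L w⟫ = ∑ i, ∑ j, matOf L i j * (v i * w j) := by
  have hw : w = ∑ j, w j • EuclideanSpace.single j (1 : ℝ) := by
    ext i; simp [Finset.sum_apply, Pi.single_apply]
  conv_lhs => rw [hw]
  rw [map_sum, inner_sum, Finset.sum_comm]
  refine Finset.sum_congr rfl fun j _ => ?_
  rw [map_smul, inner_smul_right]
  simp only [PiLp.inner_apply, RCLike.inner_apply, conj_trivial, Finset.mul_sum, matOf, Matrix.of_apply]
  refine Finset.sum_congr rfl fun i _ => ?_
  ring

lemma UB_coord {n : ℕ} (v : UB n) (i : Fin n) : |(v : Euc n) i| ≤ 1 :=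
  (PiLp.norm_apply_le (v : Euc n) i).trans (UB_norm v)

/-- barycentre of a measure on pairs -/
def bary {n m : ℕ} (ρ : Measure (UB m × UB n)) : Matrix (Fin m) (Fin n) ℝ :=
  Matrix.of fun i j => ∫ p, (p.1 : Euc m) i * (p.2 : Euc n) j ∂ρ

lemma integrable_coord {n m : ℕ} (ρ : Measure (UB m × UB n)) [IsFiniteMeasure ρ] (i : Fin m) (j : Fin n) :
    Integrable (fun p : UB m × UB n => (p.1 : Euc m) i * (p.2 : Euc n) j) ρ := by
  refine Integrable.of_bound (C := 1) (Continuous.aestronglyMeasurable (by fun_prop)) ?_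
  refine ae_of_all _ fun p => ?_
  rw [norm_mul]
  exact mul_le_one₀ (UB_coord _ _) (norm_nonneg _) (UB_coord _ _)

lemma integral_bary {n m : ℕ} (ρ : Measure (UB m × UB n)) [IsFiniteMeasure ρ] (L : Euc n →L[ℝ] Euc m) :
    ∫ p, ⟪(p.1 : Euc m), L p.2⟫ ∂ρ = frob (matOf L) (bary ρ) := by
  simp only [inner_eq_sum]
  rw [frob_eq_sum]
  have h1 : ∀ i j, Integrable (fun p : UB m × UB n => matOf L i j * ((p.1 : Euc m) i * (p.2 : Euc n) j)) ρ :=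
    fun i j => (integrable_coord ρ i j).const_mul _
  refine (integral_finsetSum _ fun i _ => integrable_finsetSum _ fun j _ => h1 i j).trans ?_
  refine Finset.sum_congr rfl fun i _ => ?_
  refine (integral_finsetSum _ fun j _ => h1 i j).trans ?_
  refine Finset.sum_congr rfl fun j _ => ?_
  rw [integral_const_mul]; rfl

lemma trN_bary_le {n m : ℕ} (ρ : Measure (UB m × UB n)) [IsProbabilityMeasure ρ] : trN (bary ρ) ≤ 1 := by
  obtain ⟨U, hU, hU'⟩ := exists_polar (bary ρ)
  rw [← hU', ← integral_bary]
  have : ∫ p : UB m × UB n, ⟪(p.1 : Euc m), U p.2⟫ ∂ρ ≤ ∫ p : UB m × UB n, (1 : ℝ) ∂ρ := by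
    refine integral_mono ?_ (integrable_const _) fun p => (le_abs_self _).trans ((inner_UB_le U _ _).trans hU)
    refine Integrable.of_bound (C := 1) (Continuous.aestronglyMeasurable (by fun_prop)) ?_
    exact ae_of_all _ fun p => (inner_UB_le U _ _).trans hU
  simpa using this

/-- A matrix measure from a finite measure and a matrix density. -/
lemma exists_matMeas {n m : ℕ} (ν : Measure (Euc n)) [IsFiniteMeasure ν]
    (h : Euc n → Matrix (Fin m) (Fin n) ℝ) (hm : ∀ i j, Measurable fun x => h x i j)
    (hb : ∀ x, trN (h x) ≤ 1) :
    ∃ M : MatMeas n m, M.tvNorm ≤ (ν Set.univ).toReal ∧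
      ∀ G : Euc n → Matrix (Fin m) (Fin n) ℝ, M.pair G = ∫ x, frob (G x) (h x) ∂ν := by
  have ht : Measurable fun x => trN (h x) := measurable_trN hm
  have hle : ν.withDensity (fun x => ENNReal.ofReal (trN (h x))) Set.univ ≤ ν Set.univ := by
    rw [withDensity_apply _ MeasurableSet.univ, Measure.restrict_univ]
    refine (lintegral_mono (g := fun _ => 1) fun x => ?_).trans (by simp)
    exact ENNReal.ofReal_le_one.2 (hb x)
  refine ⟨⟨ν.withDensity (fun x => ENNReal.ofReal (trN (h x))), fun x => (trN (h x))⁻¹ • h x,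
    ⟨hle.trans_lt (measure_lt_top _ _)⟩, ?_, ?_⟩, ?_, ?_⟩
  · intro i j
    simp only [Matrix.smul_apply, smul_eq_mul]
    exact ht.inv.mul (hm i j)
  · rw [ae_withDensity_iff (by fun_prop)]
    refine ae_of_all _ fun x hx => ?_
    have hx' : 0 < trN (h x) := by simpa using hx
    change trN _ = 1
    rw [trN_smul (inv_pos.2 hx').le, inv_mul_cancel₀ hx'.ne']
  · exact ENNReal.toReal_mono (measure_ne_top _ _) hle
  · intro G
    unfold MatMeas.pair
    simp only
    rw [integral_withDensity_eq_integral_toReal_smul (by fun_prop) (ae_of_all _ fun x => ENNReal.ofReal_lt_top)]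
    refine integral_congr_ae (ae_of_all _ fun x => ?_)
    simp only
    rw [ENNReal.toReal_ofReal (trN_nonneg _), frob_smul_right, smul_eq_mul]
    by_cases h0 : trN (h x) = 0
    · rw [trN_eq_zero h0]; simp [frob]
    · rw [mul_inv_cancel_left₀ h0]

lemma exists_M0 {n m : ℕ} (μ : VecMeas n m) (hzero : μ.totalZero) (hmom : μ.finiteFirstMoment) :
    ∃ M : MatMeas n m, IsNegDiv M μ ∧ M.tvNorm ≤ sSup (Jset0 μ) := by
  have hJ : 0 ≤ sSup (Jset0 μ) :=
    le_csSup ((Jset_bdd μ hzero hmom).mono (Jset0_subset μ)) (zero_mem_Jset0 μ)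
  obtain ⟨π, hp, hpair⟩ := exists_pi μ hzero hmom
  have : IsFiniteMeasure π := ⟨hp.trans_lt ENNReal.ofReal_lt_top⟩
  obtain ⟨M, hM1, hM2⟩ := exists_matMeas π.fst (fun x => bary (π.condKernel x)) (by
      intro i j
      simp only [bary, Matrix.of_apply]
      refine StronglyMeasurable.measurable ?_
      have hc : StronglyMeasurable (fun p : UB m × UB n => (p.1 : Euc m) i * (p.2 : Euc n) j) :=
        Continuous.stronglyMeasurable (by fun_prop)
      exact hc.integral_kernel) (fun x => trN_bary_le _)
  refine ⟨M, fun f hf => ?_, hM1.trans ?_⟩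
  · rw [hpair f hf, hM2]
    refine (Measure.integral_condKernel (ρ := π) ?_).symm.trans ?_
    rotate_left
    · refine integral_congr_ae (ae_of_all _ fun x => ?_)
      exact integral_bary (π.condKernel x) (fderiv ℝ f x)
    · obtain ⟨C, hC⟩ := hf.bdd
      have : Continuous (fderiv ℝ f) := hf.1.continuous_fderiv one_ne_zero
      refine Integrable.of_bound (C := C) (Continuous.aestronglyMeasurable (by fun_prop)) ?_
      exact ae_of_all _ fun y => (inner_UB_le _ _ _).trans (hC y.1)
  · rw [Measure.fst_univ]
    exact ENNReal.toReal_le_of_le_ofReal hJ hp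

/-- **Theorem 3.3 (duality for optimal transport of vector measures)**: for any
μ ∈ 𝓜(ℝⁿ, ℝᵐ) with μ(ℝⁿ) = 0 and finite first moments, I(μ) = J(μ); the
supremum J(μ) is attained by a 1-Lipschitz map u₀, the infimum I(μ) is attained
by some M₀ with −div M₀ = μ; J(μ) is also the supremum over C¹₀ maps of
C¹-norm at most one; and for any pair of optimisers u₀, M₀ such that u₀ is
differentiable ‖M₀‖₁-a.e. one has ⟨Du₀, dM₀/d‖M₀‖₁⟩ = 1, ‖M₀‖₁-a.e. -/
theorem vector_transport_duality {n m : ℕ} (μ : VecMeas n m)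
    (hzero : μ.totalZero) (hmom : μ.finiteFirstMoment) :
    Iinf μ = Jsup μ ∧
    (∃ u₀ : Euc n → Euc m, LipschitzWith 1 u₀ ∧ Jsup μ = μ.pair u₀) ∧
    (∃ M₀ : MatMeas n m, IsNegDiv M₀ μ ∧ Iinf μ = M₀.tvNorm) ∧
    Jsup μ = sSup {r | ∃ f : Euc n → Euc m, C1z f ∧ C1Norm f ≤ 1 ∧ r = μ.pair f} ∧
    (∀ (u₀ : Euc n → Euc m) (M₀ : MatMeas n m),
      LipschitzWith 1 u₀ → Jsup μ = μ.pair u₀ →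
      IsNegDiv M₀ μ → Iinf μ = M₀.tvNorm →
      (∀ᵐ x ∂M₀.var, DifferentiableAt ℝ u₀ x) →
      ∀ᵐ x ∂M₀.var, frob (fderivMat u₀ x) (M₀.density x) = 1) := by

  have hJ : Jsup μ = sSup (Jset μ) := rfl
  have hlow : ∀ M : MatMeas n m, IsNegDiv M μ → Jsup μ ≤ M.tvNorm := fun M hM => weak_duality hmom hM
  obtain ⟨M, hM, hMle⟩ := exists_M0 μ hzero hmom
  rw [← Jsup_eq μ hzero hmom, ← hJ] at hMle
  have hMeq : M.tvNorm = Jsup μ := le_antisymm hMle (hlow M hM)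
  have hI : Iinf μ = Jsup μ := by
    apply le_antisymm
    · rw [← hMeq]
      refine csInf_le ⟨Jsup μ, ?_⟩ ⟨M, hM, rfl⟩
      rintro r ⟨M', hM', rfl⟩
      exact hlow M' hM'
    · refine le_csInf ⟨_, M, hM, rfl⟩ ?_
      rintro r ⟨M', hM', rfl⟩
      exact hlow M' hM'
  refine ⟨hI, exists_u0 μ hzero hmom, ⟨M, hM, hI.trans hMeq.symm⟩, Jsup_eq μ hzero hmom, ?_⟩
  intro u₀ M₀ hu hu' hM₀ hM₀' hd
  exact part_iv hmom hM₀ hu hd (by rw [← hu', ← hI, hM₀'])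
end
end
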